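/- arXiv:0804.0493 — 4 statements merged into one kernel-verified Lean document; each statement's English description precedes it below -/
import Mathlib

section
/- Let Ω be a bounded domain in ℂⁿ which has a barrier at some point p ∈ ∂Ω. Let q ∈ Ω and let γ_k be automorphisms of Ω with γ_k(q) → p as k → ∞. Then γ_k(z) → p uniformly on compact subsets of Ω. -/
open Set Metric Filter MeasureTheory Topology

noncomputable section

variable {E : Type*} [NormedAddCommGroup E] [NormedSpace ℂ E]

/-- `f` is an automorphism (biholomorphic self-map) of the domain `Ω`. -/
def IsAutOn (Ω : Set E) (f : E → E) : Prop :=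
  DifferentiableOn ℂ f Ω ∧ MapsTo f Ω Ω ∧
    ∃ g : E → E, DifferentiableOn ℂ g Ω ∧ MapsTo g Ω Ω ∧
      EqOn (g ∘ f) id Ω ∧ EqOn (f ∘ g) id Ω

/-- `Γ` is a group of automorphisms of the domain `Ω`. -/
structure IsAutGroupOn (Ω : Set E) (Γ : Set (E → E)) : Prop where
  aut : ∀ γ ∈ Γ, IsAutOn Ω γ
  id_mem : id ∈ Γ
  comp_mem : ∀ γ ∈ Γ, ∀ σ ∈ Γ, γ ∘ σ ∈ Γ
  inv_mem : ∀ γ ∈ Γ, ∃ σ ∈ Γ, EqOn (σ ∘ γ) id Ω ∧ EqOn (γ ∘ σ) id Ω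

/-- `Γ` acts properly discontinuously on `Ω`: for any pair of compact subsets of `Ω`
only finitely many elements of `Γ` move the first one into the second one. -/
def ProperlyDiscontinuousOn (Ω : Set E) (Γ : Set (E → E)) : Prop :=
  ∀ K₁ K₂ : Set E, K₁ ⊆ Ω → K₂ ⊆ Ω → IsCompact K₁ → IsCompact K₂ →
    {γ ∈ Γ | (γ '' K₁ ∩ K₂).Nonempty}.Finite

/-- The action of `Γ` on `Ω` is free: an element with a fixed point acts as the identity. -/
def FreeActionOn (Ω : Set E) (Γ : Set (E → E)) : Prop :=
  ∀ γ ∈ Γ, (∃ z ∈ Ω, γ z = z) → EqOn γ id Ω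

/-- Plurisubharmonicity of an `EReal`-valued function `u` on `Ω`: `u` is upper
semicontinuous and, on every closed disc inside `Ω` on every complex line, `u` is dominated
by any harmonic function (real part of a holomorphic function) dominating it on the
boundary circle. -/
def IsPSHOn (u : E → EReal) (Ω : Set E) : Prop :=
  UpperSemicontinuousOn u Ω ∧
  ∀ z v : E, ∀ r : ℝ, 0 < r → (∀ w : ℂ, ‖w‖ ≤ r → z + w • v ∈ Ω) →
    ∀ f : ℂ → ℂ, Differentiable ℂ f →
      (∀ w : ℂ, ‖w‖ = r → u (z + w • v) ≤ ((f w).re : EReal)) →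
      ∀ w : ℂ, ‖w‖ ≤ r → u (z + w • v) ≤ ((f w).re : EReal)

/-- Plurisubharmonicity for a real-valued function. -/
def IsPSHOnR (u : E → ℝ) (Ω : Set E) : Prop :=
  IsPSHOn (fun z => (u z : EReal)) Ω

/-- The Laplacian at `0` of `w ↦ u (z + w • v)`, `w ∈ ℂ`; up to the factor `1/4` this is
the Levi form of `u` at `z` evaluated at the direction `v`. -/
def lineLaplacian (u : E → ℝ) (z v : E) : ℝ :=
  deriv (deriv fun t : ℝ => u (z + (t : ℂ) • v)) 0 +
  deriv (deriv fun t : ℝ => u (z + ((t : ℂ) * Complex.I) • v)) 0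

/-- Strict plurisubharmonicity (for a `C²` function): the Levi form is positive definite
at every point of `Ω`. -/
def IsStrictPSHOn (u : E → ℝ) (Ω : Set E) : Prop :=
  ∀ z ∈ Ω, ∀ v : E, v ≠ 0 → 0 < lineLaplacian u z v

/-- The quotient manifold `Ω/Γ` is Stein: `Γ`-invariant holomorphic functions (that is,
holomorphic functions of the quotient) separate the points of the quotient, and the
quotient is holomorphically convex: the holomorphically convex hull (in the quotient) of
any compact set is compact, i.e. is contained in the `Γ`-saturation of a compact subset
of `Ω`. -/
def QuotientIsStein (Ω : Set E) (Γ : Set (E → E)) : Prop :=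
  (∀ z ∈ Ω, ∀ w ∈ Ω, (∀ γ ∈ Γ, γ z ≠ w) →
      ∃ f : E → ℂ, DifferentiableOn ℂ f Ω ∧ (∀ γ ∈ Γ, ∀ x ∈ Ω, f (γ x) = f x) ∧
        f z ≠ f w) ∧
  (∀ K : Set E, K ⊆ Ω → IsCompact K → ∃ L : Set E, L ⊆ Ω ∧ IsCompact L ∧
      {z ∈ Ω | ∀ f : E → ℂ, DifferentiableOn ℂ f Ω →
          (∀ γ ∈ Γ, ∀ x ∈ Ω, f (γ x) = f x) →
          ‖f z‖ ≤ sSup ((fun x => ‖f x‖) '' K)} ⊆ ⋃ γ ∈ Γ, γ '' L)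

/-- The quotient manifold `Ω/Γ` possesses a negative `C^∞` strictly plurisubharmonic
function, i.e. there is a `Γ`-invariant negative `C^∞` strictly plurisubharmonic function
on `Ω`. -/
def QuotientHasNegSPSH (Ω : Set E) (Γ : Set (E → E)) : Prop :=
  ∃ u : E → ℝ, (∀ γ ∈ Γ, ∀ z ∈ Ω, u (γ z) = u z) ∧ (∀ z ∈ Ω, u z < 0) ∧
    ContDiffOn ℝ (⊤ : ℕ∞) u Ω ∧ IsStrictPSHOn u Ω

/-- The pluricomplex Green function of `Ω` with pole `w`. -/
def pcGreen (Ω : Set E) (z w : E) : EReal :=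
  sSup {t : EReal | ∃ u : E → EReal, IsPSHOn u Ω ∧ (∀ x ∈ Ω, u x < 0) ∧
    (∃ C : ℝ, ∀ᶠ x in 𝓝[Ω \ {w}] w, u x ≤ ((Real.log ‖x - w‖ + C : ℝ) : EReal)) ∧
    t = u z}

/-- The pluricomplex Green function of `Ω` with pole `w` exists: it has a logarithmic
pole at `w` and is bounded away from `-∞` outside a neighborhood of `w`. -/
def GreenExistsAt (Ω : Set E) (w : E) : Prop :=
  (∃ C : ℝ, ∀ᶠ z in 𝓝[Ω \ {w}] w,
      ((Real.log ‖z - w‖ - C : ℝ) : EReal) ≤ pcGreen Ω z w ∧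
        pcGreen Ω z w ≤ ((Real.log ‖z - w‖ + C : ℝ) : EReal)) ∧
  ∃ r : ℝ, 0 < r ∧ ∃ C : ℝ, ∀ z ∈ Ω, z ∉ ball w r → ((-C : ℝ) : EReal) ≤ pcGreen Ω z w

/-- `Ω` is pluricomplex hyperbolic. -/
def PlcpxHyperbolic (Ω : Set E) : Prop :=
  ∀ w ∈ Ω, GreenExistsAt Ω w

/-- `Ω` is a Stein domain: it is open, holomorphically convex, and holomorphic functions
separate its points. -/
def IsSteinDomain (Ω : Set E) : Prop :=
  IsOpen Ω ∧
  (∀ K : Set E, K ⊆ Ω → IsCompact K →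
      IsCompact {z ∈ Ω | ∀ f : E → ℂ, DifferentiableOn ℂ f Ω →
        ‖f z‖ ≤ sSup ((fun x => ‖f x‖) '' K)}) ∧
  ∀ z ∈ Ω, ∀ w ∈ Ω, z ≠ w → ∃ f : E → ℂ, DifferentiableOn ℂ f Ω ∧ f z ≠ f w

/-- The pluricomplex Green function of the quotient `Ω/Γ` with pole `π w`, pulled back to
`Ω`: the supremum of all `Γ`-invariant negative plurisubharmonic functions on `Ω` with a
logarithmic pole at `w`. -/
def quotGreen (Ω : Set E) (Γ : Set (E → E)) (z w : E) : EReal :=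
  sSup {t : EReal | ∃ u : E → EReal, IsPSHOn u Ω ∧ (∀ x ∈ Ω, u x < 0) ∧
    (∀ γ ∈ Γ, ∀ x ∈ Ω, u (γ x) = u x) ∧
    (∃ C : ℝ, ∀ᶠ x in 𝓝[Ω \ {w}] w, u x ≤ ((Real.log ‖x - w‖ + C : ℝ) : EReal)) ∧
    t = u z}

/-- The pluricomplex Green function of the quotient `Ω/Γ` with pole `π w` exists. -/
def QuotientGreenExistsAt (Ω : Set E) (Γ : Set (E → E)) (w : E) : Prop :=
  (∃ C : ℝ, ∀ᶠ z in 𝓝[Ω \ {w}] w,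
      ((Real.log ‖z - w‖ - C : ℝ) : EReal) ≤ quotGreen Ω Γ z w ∧
        quotGreen Ω Γ z w ≤ ((Real.log ‖z - w‖ + C : ℝ) : EReal)) ∧
  ∃ r : ℝ, 0 < r ∧ ∃ C : ℝ, ∀ z ∈ Ω, (∀ γ ∈ Γ, γ z ∉ ball w r) →
    ((-C : ℝ) : EReal) ≤ quotGreen Ω Γ z w

/-- The quotient `Ω/Γ` is pluricomplex hyperbolic. -/
def QuotientPlcpxHyperbolic (Ω : Set E) (Γ : Set (E → E)) : Prop :=
  ∀ w ∈ Ω, QuotientGreenExistsAt Ω Γ w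

/-- `D` is a fundamental domain for the action of `Γ` on `Ω`. -/
def IsFundamentalDomainOn (Ω : Set E) (Γ : Set (E → E)) (D : Set E) : Prop :=
  D ⊆ Ω ∧ (∀ z ∈ Ω, ∃ γ ∈ Γ, γ z ∈ D) ∧
    ∀ z ∈ D, ∀ w ∈ D, (∃ γ ∈ Γ, γ z = w) → z = w

/-- The orbit of the point `a` under `Γ`. -/
def orbitOf (Γ : Set (E → E)) (a : E) : Set E := (fun γ : E → E => γ a) '' Γ

/-- The set of cluster (accumulation) points of the orbit of `a` under `Γ`. -/
def clusterPtsOfOrbit (Γ : Set (E → E)) (a : E) : Set E :=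
  {b : E | AccPt b (𝓟 (orbitOf Γ a))}

/-- The limit set of `Γ` acting on the bounded domain `Ω`. -/
def limitSet (Ω : Set E) (Γ : Set (E → E)) : Set E :=
  {w ∈ frontier Ω | ∃ K : Set E, K ⊆ Ω ∧ IsCompact K ∧
    ∃ z : ℕ → E, (∀ k, z k ∈ Ω) ∧ Tendsto z atTop (𝓝 w) ∧
      ∃ γ : ℕ → E → E, (∀ k, γ k ∈ Γ) ∧ ∀ k, γ k (z k) ∈ K}

/-- `ψ` is a barrier at the boundary point `p` of `Ω`. -/
def IsBarrierAt (Ω : Set E) (p : E) (ψ : E → ℝ) : Prop :=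
  ContinuousOn ψ (closure Ω) ∧ IsPSHOnR ψ Ω ∧ ψ p = 0 ∧
    ∀ z ∈ closure Ω, z ≠ p → ψ z < 0

/-- `Ω` is B-regular: there is a barrier at every boundary point. -/
def BRegular (Ω : Set E) : Prop :=
  ∀ p ∈ frontier Ω, ∃ ψ : E → ℝ, IsBarrierAt Ω p ψ

/-- Integer iterates of a map `f` with (two-sided) inverse `g`. -/
def zIter (f g : E → E) : ℤ → E → E
  | Int.ofNat k => f^[k]
  | Int.negSucc k => g^[k + 1]

/-- `Γ` is an (algebraically) cyclic group of automorphisms of `Ω`: it consists of the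
integer powers of a single automorphism. -/
def IsCyclicAutGroupOn (Ω : Set E) (Γ : Set (E → E)) : Prop :=
  ∃ γ ∈ Γ, ∃ γ' ∈ Γ, EqOn (γ' ∘ γ) id Ω ∧ EqOn (γ ∘ γ') id Ω ∧
    (∀ k : ℤ, zIter γ γ' k ∈ Γ) ∧ ∀ σ ∈ Γ, ∃ k : ℤ, EqOn σ (zIter γ γ' k) Ω

/-- The complex Jacobian determinant of `γ` at `z`. -/
def jacDet (γ : E → E) (z : E) : ℂ :=
  LinearMap.det ((fderiv ℂ γ z : E →L[ℂ] E) : E →ₗ[ℂ] E)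

section Barrier

variable {F : Type*} [NormedAddCommGroup F] [InnerProductSpace ℂ F]

/-- Second order Taylor expansion of an analytic curve. -/
lemma AnalyticAt.exists_isLittleO_sub_sq {φ : ℂ → F} {ζ : ℂ} (hφ : AnalyticAt ℂ φ ζ) :
    ∃ c : F, (fun w : ℂ => φ (ζ + w) - φ ζ - w • deriv φ ζ - w ^ 2 • c) =o[𝓝 0]
      fun w : ℂ => ‖w‖ ^ 2 := by
  obtain ⟨P, hP⟩ := hφ
  refine ⟨P.coeff 2, ?_⟩
  have h := hP.isBigO_sub_partialSum_pow 3
  have h3 : (fun w : ℂ => ‖w‖ ^ 3) =o[𝓝 0] fun w : ℂ => ‖w‖ ^ 2 :=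
    (Asymptotics.isLittleO_pow_pow (𝕜 := ℝ) (by norm_num : 2 < 3)).comp_tendsto
      (tendsto_norm_zero (E := ℂ))
  refine (h.trans_isLittleO h3).congr_left fun w => ?_
  have h0 : P.coeff 0 = φ ζ := hP.coeff_zero _
  have h1 : P.coeff 1 = deriv φ ζ := hP.deriv.symm
  simp only [FormalMultilinearSeries.partialSum, Finset.sum_range_succ, Finset.sum_range_zero,
    FormalMultilinearSeries.apply_eq_pow_smul_coeff, h0, h1, pow_zero, pow_one, one_smul, zero_add]
  abel

/-- Along an analytic curve, the squared distance from a fixed vector to the first order Taylor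
remainder is, up to a small multiple of `‖w‖ ^ 2`, dominated by the real part of a polynomial. -/
lemma AnalyticAt.exists_norm_sub_sq_le {φ : ℂ → F} {ζ : ℂ} (hφ : AnalyticAt ℂ φ ζ) (h : F)
    {N δ : ℝ} (hN : 0 ≤ N) (hδ : 0 < δ) :
    ∃ c : ℂ, ∀ᶠ w : ℂ in 𝓝 0,
      N * ‖h - (φ (ζ + w) - φ ζ - w • deriv φ ζ)‖ ^ 2 ≤
        N * ‖h‖ ^ 2 + (c * w ^ 2).re + δ * ‖w‖ ^ 2 := by
  obtain ⟨a, ha⟩ := hφ.exists_isLittleO_sub_sq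
  set κ : ℝ := δ / (2 * N * ‖h‖ + N + 1) with hκ
  have hD : 0 < 2 * N * ‖h‖ + N + 1 := by positivity
  have hκ0 : 0 < κ := by positivity
  have hκD : κ * (2 * N * ‖h‖ + N + 1) = δ := div_mul_cancel₀ _ hD.ne'
  have e1 := ha.bound hκ0
  have e2 : ∀ᶠ w : ℂ in 𝓝 0, (‖a‖ + κ) ^ 2 * ‖w‖ ^ 2 ≤ κ := by
    have : Tendsto (fun w : ℂ => (‖a‖ + κ) ^ 2 * ‖w‖ ^ 2) (𝓝 0) (𝓝 0) := by
      have : Continuous fun w : ℂ => (‖a‖ + κ) ^ 2 * ‖w‖ ^ 2 := by fun_prop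
      simpa using this.tendsto 0
    exact this.eventually_le_const hκ0
  refine ⟨-2 * N * inner ℂ h a, ?_⟩
  filter_upwards [e1, e2] with w h1 h2
  set R := φ (ζ + w) - φ ζ - w • deriv φ ζ with hR
  have hw : ‖(‖w‖ ^ 2 : ℝ)‖ = ‖w‖ ^ 2 := by simp
  rw [hw] at h1
  have hRn : ‖R‖ ≤ (‖a‖ + κ) * ‖w‖ ^ 2 := by
    have := norm_add_le (R - w ^ 2 • a) (w ^ 2 • a)
    rw [sub_add_cancel, norm_smul, norm_pow] at this
    linarith
  have hR2 : ‖R‖ ^ 2 ≤ κ * ‖w‖ ^ 2 := by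
    have h0 : ‖R‖ ^ 2 ≤ ((‖a‖ + κ) * ‖w‖ ^ 2) ^ 2 := by gcongr
    nlinarith [sq_nonneg ‖w‖]
  clear_value R
  have hin : (inner ℂ h R).re = (inner ℂ h a * w ^ 2).re + (inner ℂ h (R - w ^ 2 • a)).re := by
    rw [inner_sub_right, inner_smul_right]
    simp [mul_comm]
  have hin2 : -(‖h‖ * (κ * ‖w‖ ^ 2)) ≤ (inner ℂ h (R - w ^ 2 • a)).re := by
    have h3 := Complex.abs_re_le_norm (inner ℂ h (R - w ^ 2 • a))
    have h4 := norm_inner_le_norm (𝕜 := ℂ) h (R - w ^ 2 • a)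
    have h5 := mul_le_mul_of_nonneg_left h1 (norm_nonneg h)
    linarith [neg_abs_le (inner ℂ h (R - w ^ 2 • a)).re]
  have hexp := norm_sub_sq (𝕜 := ℂ) h R
  have hre : RCLike.re (inner ℂ h R) = (inner ℂ h R).re := rfl
  rw [hre] at hexp
  have hc : (-2 * (N : ℂ) * inner ℂ h a * w ^ 2).re = -2 * N * (inner ℂ h a * w ^ 2).re := by
    have : (-2 * (N : ℂ) * inner ℂ h a * w ^ 2) =
      ((-2 * N : ℝ) : ℂ) * (inner ℂ h a * w ^ 2) := by push_cast; ring
    rw [this, Complex.re_ofReal_mul]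
  rw [hexp, hc, hin, ← hκD]
  have h6 := mul_le_mul_of_nonneg_left hin2 hN
  have h7 := mul_le_mul_of_nonneg_left hR2 hN
  have h8 : 0 ≤ κ * ‖w‖ ^ 2 := by positivity
  nlinarith

/-- A continuous plurisubharmonic function, composed with an analytic curve and perturbed by a
strictly subharmonic function, satisfies the maximum principle. -/
lemma IsPSHOnR.comp_add_le [ProperSpace F] {Ω : Set F} {ψ : F → ℝ} (hψ : IsPSHOnR ψ Ω)
    (hΩ : IsOpen Ω) (hψc : ContinuousOn ψ Ω) {K : Set ℂ} (hK : IsCompact K) {φ : ℂ → F}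
    (hφ : ∀ ζ ∈ K, AnalyticAt ℂ φ ζ) (hφΩ : MapsTo φ K Ω) {β : ℂ → ℝ} (hβc : ContinuousOn β K)
    (hβ : ∀ ζ ∈ interior K, ∃ c₁ c₂ : ℂ, ∃ δ : ℝ, 0 < δ ∧ ∀ᶠ w : ℂ in 𝓝 0,
      β ζ + (c₁ * w + c₂ * w ^ 2).re + δ * ‖w‖ ^ 2 ≤ β (ζ + w))
    {m : ℝ} (hm : ∀ ζ ∈ K, ζ ∉ interior K → ψ (φ ζ) + β ζ ≤ m) :
    ∀ ζ ∈ K, ψ (φ ζ) + β ζ ≤ m := by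
  by_contra! hcon
  obtain ⟨ζ', hζ'K, hζ'⟩ := hcon
  obtain ⟨η, hη, hη'⟩ : ∃ η > 0, m + 2 * η < ψ (φ ζ') + β ζ' :=
    ⟨(ψ (φ ζ') + β ζ' - m) / 4, by linarith, by linarith⟩
  have hφc : ContinuousOn φ K := fun ζ hζ => (hφ ζ hζ).continuousAt.continuousWithinAt
  have hφK : IsCompact (φ '' K) := hK.image_of_continuousOn hφc
  obtain ⟨τ₀, hτ₀, hL⟩ := hφK.exists_cthickening_subset_open hΩ hφΩ.image_subset
  have hLc : IsCompact (cthickening τ₀ (φ '' K)) := hφK.cthickening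
  have huc := hLc.uniformContinuousOn_of_continuous (hψc.mono hL)
  rw [Metric.uniformContinuousOn_iff_le] at huc
  obtain ⟨τ₁, hτ₁, huc⟩ := huc η hη
  set τ := min τ₀ τ₁ with hτdef
  have hτ : 0 < τ := lt_min hτ₀ hτ₁
  have hmem : ∀ ζ ∈ K, ∀ h : F, ‖h‖ ≤ τ → φ ζ + h ∈ cthickening τ₀ (φ '' K) := fun ζ hζ h hh =>
    mem_cthickening_of_dist_le _ _ _ _ (mem_image_of_mem φ hζ)
      (by simpa using hh.trans (min_le_left _ _))
  have hclose : ∀ ζ ∈ K, ∀ h : F, ‖h‖ ≤ τ → ψ (φ ζ + h) ≤ ψ (φ ζ) + η := fun ζ hζ h hh => by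
    have := huc _ (hmem ζ hζ h hh) _ (hmem ζ hζ 0 (by simpa using hτ.le))
      (by simpa using hh.trans (min_le_right _ _))
    rw [Real.dist_eq, add_zero] at this
    linarith [le_abs_self (ψ (φ ζ + h) - ψ (φ ζ))]
  have hψφ : ContinuousOn (fun ζ => ψ (φ ζ) + β ζ) K := (hψc.comp hφc hφΩ).add hβc
  obtain ⟨M, hM⟩ := hK.bddAbove_image hψφ
  have hM : ∀ ζ ∈ K, ψ (φ ζ) + β ζ ≤ M := fun ζ hζ => hM (mem_image_of_mem _ hζ)
  obtain ⟨N, hN, hNτ⟩ : ∃ N : ℝ, 0 ≤ N ∧ M - m < N * τ ^ 2 :=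
    ⟨(|M - m| + 1) / τ ^ 2, by positivity, by
      rw [div_mul_cancel₀ _ (by positivity)]; linarith [le_abs_self (M - m)]⟩
  -- maximise the penalised function over the tube around the curve
  have hGc : ContinuousOn (fun x : ℂ × F => ψ (φ x.1 + x.2) + β x.1 - N * ‖x.2‖ ^ 2)
      (K ×ˢ closedBall 0 τ) := by
    have h1 : ContinuousOn (fun x : ℂ × F => φ x.1) (K ×ˢ closedBall 0 τ) :=
      hφc.comp continuousOn_fst fun x hx => hx.1
    have h2 : ContinuousOn (fun x : ℂ × F => β x.1) (K ×ˢ closedBall 0 τ) :=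
      hβc.comp continuousOn_fst fun x hx => hx.1
    have h3 : ContinuousOn (fun x : ℂ × F => ψ (φ x.1 + x.2)) (K ×ˢ closedBall 0 τ) :=
      hψc.comp (h1.add continuousOn_snd) fun x hx =>
        hL (hmem x.1 hx.1 x.2 (by simpa using hx.2))
    exact (h3.add h2).sub (by fun_prop)
  obtain ⟨⟨ζ₀, h₀⟩, ⟨hζ₀, hh₀⟩, hmax⟩ := (hK.prod (isCompact_closedBall (0 : F) τ)).exists_isMaxOn
    ⟨(ζ', 0), hζ'K, by simpa using hτ.le⟩ hGc
  simp only [mem_closedBall, dist_zero_right] at hζ₀ hh₀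
  have hmax : ∀ ζ ∈ K, ∀ h : F, ‖h‖ ≤ τ →
      ψ (φ ζ + h) + β ζ - N * ‖h‖ ^ 2 ≤ ψ (φ ζ₀ + h₀) + β ζ₀ - N * ‖h₀‖ ^ 2 :=
    fun ζ hζ h hh => hmax (show (ζ, h) ∈ K ×ˢ closedBall 0 τ from ⟨hζ, by simpa using hh⟩)
  have hbig : m + 2 * η < ψ (φ ζ₀ + h₀) + β ζ₀ - N * ‖h₀‖ ^ 2 := by
    have := hmax ζ' hζ'K 0 (by simpa using hτ.le)
    simp only [add_zero, norm_zero] at this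
    linarith
  have hcl := hclose ζ₀ hζ₀ h₀ hh₀
  have hh₀' : ‖h₀‖ < τ := by
    refine lt_of_le_of_ne hh₀ fun heq => ?_
    rw [heq] at hbig
    linarith [hM ζ₀ hζ₀]
  have hint : ζ₀ ∈ interior K := by
    by_contra hni
    have : 0 ≤ N * ‖h₀‖ ^ 2 := by positivity
    linarith [hm ζ₀ hζ₀ hni]
  obtain ⟨c₁, c₂, δ, hδ, hβev⟩ := hβ ζ₀ hint
  obtain ⟨c, hc⟩ := (hφ ζ₀ hζ₀).exists_norm_sub_sq_le h₀ hN (half_pos hδ)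
  set b := deriv φ ζ₀ with hb
  have hcont : ContinuousAt (fun w : ℂ => h₀ - (φ (ζ₀ + w) - φ ζ₀ - w • b)) 0 := by
    have : ContinuousAt (fun w : ℂ => φ (ζ₀ + w)) 0 :=
      ContinuousAt.comp (g := φ) (by simpa using (hφ ζ₀ hζ₀).continuousAt) (by fun_prop)
    exact continuousAt_const.sub ((this.sub continuousAt_const).sub (by fun_prop))
  have hsmall : ∀ᶠ w : ℂ in 𝓝 0, ‖h₀ - (φ (ζ₀ + w) - φ ζ₀ - w • b)‖ < τ :=
    hcont.norm.eventually_lt_const (by simpa using hh₀')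
  have hKev : ∀ᶠ w : ℂ in 𝓝 0, ζ₀ + w ∈ K := by
    have : Tendsto (fun w : ℂ => ζ₀ + w) (𝓝 0) (𝓝 ζ₀) := by
      have : Continuous fun w : ℂ => ζ₀ + w := by fun_prop
      simpa using this.tendsto 0
    exact this (mem_interior_iff_mem_nhds.1 hint)
  have hall := hβev.and (hc.and (hsmall.and hKev))
  obtain ⟨r, hr, hball⟩ := Metric.nhds_basis_closedBall.eventually_iff.1 hall
  have hdisc : ∀ w : ℂ, ‖w‖ ≤ r →
      φ ζ₀ + h₀ + w • b = φ (ζ₀ + w) + (h₀ - (φ (ζ₀ + w) - φ ζ₀ - w • b)) := fun w _ => by abel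
  have key := hψ.2 (φ ζ₀ + h₀) b r hr (fun w hw => ?_)
    (fun w => (ψ (φ ζ₀ + h₀) - δ / 2 * r ^ 2 : ℝ) - c₁ * w + (c - c₂) * w ^ 2) (by fun_prop)
    (fun w hw => ?_) 0 (by simpa using hr.le)
  · simp only [zero_smul, add_zero, mul_zero, sub_zero, ne_eq, OfNat.ofNat_ne_zero,
      not_false_eq_true, zero_pow, Complex.ofReal_re, EReal.coe_le_coe_iff] at key
    have : 0 < δ / 2 * r ^ 2 := by positivity
    linarith
  · obtain ⟨-, -, h3, h4⟩ := hball (x := w) (by simpa using hw)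
    rw [hdisc w hw]
    exact hL (hmem _ h4 _ h3.le)
  · obtain ⟨h1, h2, h3, h4⟩ := hball (x := w) (by simpa using hw.le)
    rw [EReal.coe_le_coe_iff, hdisc w hw.le]
    have h5 := hmax _ h4 _ h3.le
    rw [hw] at h1 h2
    simp only [Complex.add_re, Complex.sub_re, sub_mul, Complex.ofReal_re] at h1 ⊢
    linarith

/-- The function `ε / ‖ζ‖ ^ 2` is strictly subharmonic away from the origin. -/
lemma exists_add_re_le_inv_norm_sq {ζ : ℂ} (hζ : ζ ≠ 0) {ε : ℝ} (hε : 0 < ε) :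
    ∃ c₁ c₂ : ℂ, ∃ δ : ℝ, 0 < δ ∧ ∀ᶠ w : ℂ in 𝓝 0,
      ε * (‖ζ‖ ^ 2)⁻¹ + (c₁ * w + c₂ * w ^ 2).re + δ * ‖w‖ ^ 2 ≤ ε * (‖ζ + w‖ ^ 2)⁻¹ := by
  have base : ∀ t : ℂ, ‖t‖ ≤ 1 / 16 →
      1 + (-2 * t + 2 * t ^ 2).re + 1 / 2 * ‖t‖ ^ 2 ≤ (‖1 + t‖ ^ 2)⁻¹ := by
    intro t ht
    have hx := (Complex.abs_re_le_norm t).trans ht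
    have hsq : ‖t‖ ^ 2 = t.re ^ 2 + t.im ^ 2 := by
      rw [← Complex.normSq_eq_norm_sq, Complex.normSq_apply]; ring
    have hsq' : ‖1 + t‖ ^ 2 = (1 + t.re) ^ 2 + t.im ^ 2 := by
      rw [← Complex.normSq_eq_norm_sq, Complex.normSq_apply]; simp; ring
    have hre : (-2 * t + 2 * t ^ 2).re = -2 * t.re + 2 * (t.re ^ 2 - t.im ^ 2) := by
      simp [pow_two]
    have hn : t.re ^ 2 + t.im ^ 2 ≤ 1 / 256 := by
      rw [← hsq]; nlinarith [norm_nonneg t]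
    rw [abs_le] at hx
    have hD : 0 < (1 + t.re) ^ 2 + t.im ^ 2 := by nlinarith [sq_nonneg t.im]
    rw [hsq, hsq', hre, ← one_div, le_div_iff₀ hD]
    generalize t.re = x at *
    generalize t.im = y at *
    obtain ⟨hx1, hx2⟩ := hx
    nlinarith [mul_nonneg (sub_nonneg.2 hx1) (sq_nonneg x),
      mul_nonneg (sub_nonneg.2 hx2) (sq_nonneg x),
      mul_nonneg (sub_nonneg.2 hx1) (sq_nonneg y), mul_nonneg (sub_nonneg.2 hx2) (sq_nonneg y),
      mul_nonneg (sub_nonneg.2 hn) (sq_nonneg x), mul_nonneg (sub_nonneg.2 hn) (sq_nonneg y)]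
  have hζ' : 0 < ‖ζ‖ := norm_pos_iff.2 hζ
  refine ⟨ε * (‖ζ‖ ^ 2)⁻¹ * (-2 / ζ), ε * (‖ζ‖ ^ 2)⁻¹ * (2 / ζ ^ 2),
    ε * (‖ζ‖ ^ 2)⁻¹ * (1 / 2 * (‖ζ‖ ^ 2)⁻¹), by positivity, ?_⟩
  filter_upwards [Metric.closedBall_mem_nhds (0 : ℂ) (show 0 < ‖ζ‖ / 16 by positivity)] with w hw
  have hb := base (w / ζ) (by
    rw [norm_div, div_le_iff₀ hζ']; simp at hw; linarith)
  have h1 : ζ + w = ζ * (1 + w / ζ) := by field_simp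
  have h2 : (ε * (‖ζ‖ ^ 2)⁻¹ * (-2 / ζ) * w + ε * (‖ζ‖ ^ 2)⁻¹ * (2 / ζ ^ 2) * w ^ 2 : ℂ) =
      ((ε * (‖ζ‖ ^ 2)⁻¹ : ℝ) : ℂ) * (-2 * (w / ζ) + 2 * (w / ζ) ^ 2) := by
    push_cast; ring
  rw [h2, Complex.re_ofReal_mul, h1, norm_mul, mul_pow, mul_inv, ← mul_assoc ε]
  rw [norm_div] at hb
  have h3 := mul_le_mul_of_nonneg_left hb (show 0 ≤ ε * (‖ζ‖ ^ 2)⁻¹ by positivity)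
  refine le_trans (le_of_eq ?_) h3
  ring

/-- Two constants version of the strong maximum principle: a nonpositive plurisubharmonic function
that is very negative near the centre of a disc stays negative inside the disc. -/
lemma IsPSHOnR.comp_le_of_le_on_closedBall [ProperSpace F] {Ω : Set F} {ψ : F → ℝ}
    (hψ : IsPSHOnR ψ Ω) (hΩ : IsOpen Ω) (hψc : ContinuousOn ψ Ω) (hψ0 : ∀ z ∈ Ω, ψ z ≤ 0)
    {s R c : ℝ} (hs : 0 < s) (hsR : s < R) (hc : 0 < c) {φ : ℂ → F}
    (hφ : ∀ ζ : ℂ, ‖ζ‖ ≤ R → AnalyticAt ℂ φ ζ) (hφΩ : ∀ ζ : ℂ, ‖ζ‖ ≤ R → φ ζ ∈ Ω)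
    (hφs : ∀ ζ : ℂ, ‖ζ‖ ≤ s → ψ (φ ζ) ≤ -c) {ζ : ℂ} (hζs : s ≤ ‖ζ‖) (hζR : ‖ζ‖ ≤ R) :
    ψ (φ ζ) ≤ -(c / ((s ^ 2)⁻¹ - (R ^ 2)⁻¹) * ((‖ζ‖ ^ 2)⁻¹ - (R ^ 2)⁻¹)) := by
  have hgap : 0 < (s ^ 2)⁻¹ - (R ^ 2)⁻¹ := by
    rw [sub_pos]; gcongr
  set ε := c / ((s ^ 2)⁻¹ - (R ^ 2)⁻¹) with hε
  have hε0 : 0 < ε := by positivity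
  have hεc : ε * ((s ^ 2)⁻¹ - (R ^ 2)⁻¹) = c := div_mul_cancel₀ _ hgap.ne'
  set K : Set ℂ := closedBall 0 R \ ball 0 s with hKdef
  have hK : IsCompact K := (isCompact_closedBall _ _).diff isOpen_ball
  have hmK : ∀ z : ℂ, z ∈ K ↔ ‖z‖ ≤ R ∧ s ≤ ‖z‖ := fun z => by simp [hKdef]
  have h0 : ∀ z ∈ K, z ≠ 0 := fun z hz => norm_pos_iff.1 (hs.trans_le ((hmK z).1 hz).2)
  have := hψ.comp_add_le hΩ hψc hK (fun z hz => hφ z ((hmK z).1 hz).1)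
    (fun z hz => hφΩ z ((hmK z).1 hz).1) (β := fun z => ε * (‖z‖ ^ 2)⁻¹) (m := ε * (R ^ 2)⁻¹)
    ?_ (fun z hz => exists_add_re_le_inv_norm_sq (h0 z (interior_subset hz)) hε0) ?_ ζ
    ((hmK ζ).2 ⟨hζR, hζs⟩)
  · linarith
  · exact continuousOn_const.mul ((by fun_prop : ContinuousOn (fun z : ℂ => ‖z‖ ^ 2) K).inv₀
      fun z hz => by simpa using h0 z hz)
  · intro z hz hzi
    obtain ⟨hzR, hzs⟩ := (hmK z).1 hz
    rcases hzs.eq_or_lt with h | h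
    · have := hφs z h.ge
      rw [← h]
      linarith
    rcases hzR.eq_or_lt with h' | h'
    · rw [h']
      linarith [hψ0 _ (hφΩ z hzR)]
    · refine absurd (mem_interior.2 ⟨ball 0 R \ closedBall 0 s, ?_, ?_, ?_⟩) hzi
      · exact sdiff_subset_sdiff ball_subset_closedBall ball_subset_closedBall
      · exact isOpen_ball.sdiff isClosed_closedBall
      · simp [h, h']

/-- A barrier at `p` is bounded away from zero away from `p`. -/
lemma IsBarrierAt.exists_le_neg [ProperSpace F] {Ω : Set F} {p : F} {ψ : F → ℝ}
    (hψ : IsBarrierAt Ω p ψ) (hbdd : Bornology.IsBounded Ω) {ε : ℝ} (hε : 0 < ε) :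
    ∃ c > 0, ∀ y ∈ Ω, ε ≤ dist y p → ψ y ≤ -c := by
  obtain ⟨hψc, -, -, hneg⟩ := hψ
  have hK : IsCompact (closure Ω \ ball p ε) := hbdd.isCompact_closure.diff isOpen_ball
  obtain hemp | hne := (closure Ω \ ball p ε).eq_empty_or_nonempty
  · refine ⟨1, one_pos, fun y hy hd => ?_⟩
    exact absurd hemp (Set.Nonempty.ne_empty ⟨y, subset_closure hy, by simpa using hd⟩)
  · obtain ⟨x, hx, hmax⟩ := hK.exists_isMaxOn hne (hψc.mono sdiff_subset)
    refine ⟨-ψ x, neg_pos.2 (hneg x hx.1 fun h => hx.2 (by simpa [h] using hε)), fun y hy hd => ?_⟩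
    rw [neg_neg]
    exact hmax ⟨subset_closure hy, by simpa using hd⟩

/-- If holomorphic self-maps of a bounded domain push one point of a ball to a point admitting a
barrier, they push its centre there too. -/
lemma IsBarrierAt.tendsto_center [FiniteDimensional ℂ F] {Ω : Set F} {p : F} {ψ : F → ℝ}
    (hψ : IsBarrierAt Ω p ψ) (hopen : IsOpen Ω) (hbdd : Bornology.IsBounded Ω) (hp : p ∈ closure Ω)
    {γ : ℕ → F → F} (hγ : ∀ k, DifferentiableOn ℂ (γ k) Ω) (hγΩ : ∀ k, MapsTo (γ k) Ω Ω)
    {a z : F} {R : ℝ} (hR : closedBall a R ⊆ Ω) (hz : z ∈ ball a R)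
    (hlim : Tendsto (fun k => γ k z) atTop (𝓝 p)) : Tendsto (fun k => γ k a) atTop (𝓝 p) := by
  have : ProperSpace F := FiniteDimensional.proper ℂ F
  rcases eq_or_ne z a with rfl | hza
  · exact hlim
  have hψ0 : ∀ y ∈ Ω, ψ y ≤ 0 := fun y hy => by
    rcases eq_or_ne y p with rfl | h
    · exact hψ.2.2.1.le
    · exact (hψ.2.2.2 y (subset_closure hy) h).le
  obtain ⟨D, hD⟩ := Metric.isBounded_iff.1 hbdd
  have hzR : ‖z - a‖ < R := by simpa [dist_eq_norm] using hz
  have hza' : 0 < ‖z - a‖ := norm_pos_iff.2 (sub_ne_zero.2 hza)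
  have hR0 : 0 < R := hza'.trans hzR
  have haΩ : a ∈ Ω := hR (mem_closedBall_self hR0.le)
  have hD0 : 0 ≤ D := by simpa using hD haΩ haΩ
  rw [Metric.tendsto_nhds]
  intro ε hε
  obtain ⟨c, hc, hcψ⟩ := hψ.exists_le_neg hbdd (half_pos hε)
  obtain ⟨s, hs, hsz, hsε⟩ : ∃ s > 0, s ≤ ‖z - a‖ ∧ D / R * s ≤ ε / 2 := by
    refine ⟨min ‖z - a‖ (ε / 2 / (D / R + 1)), by positivity, min_le_left _ _, ?_⟩
    have h1 : 0 ≤ D / R := by positivity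
    calc D / R * min ‖z - a‖ (ε / 2 / (D / R + 1)) ≤ (D / R + 1) * (ε / 2 / (D / R + 1)) := by
          gcongr
          · linarith
          · exact min_le_right _ _
      _ = ε / 2 := by field_simp
  have hsR : s < R := hsz.trans_lt hzR
  set v : F := ((‖z - a‖⁻¹ : ℝ) : ℂ) • (z - a) with hv
  have hvn : ‖v‖ = 1 := by
    rw [hv, norm_smul, Complex.norm_real, norm_inv, norm_norm, inv_mul_cancel₀ hza'.ne']
  have hline : ∀ ζ : ℂ, ‖ζ‖ ≤ R → a + ζ • v ∈ Ω := fun ζ hζ => hR (by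
    simpa [norm_smul, hvn] using hζ)
  have hgap : 0 < (s ^ 2)⁻¹ - (R ^ 2)⁻¹ := by
    rw [sub_pos]; gcongr
  have hgap' : 0 < (‖z - a‖ ^ 2)⁻¹ - (R ^ 2)⁻¹ := by
    rw [sub_pos]; gcongr
  have hψlim : Tendsto (fun k => ψ (γ k z)) atTop (𝓝 0) := by
    have h1 := (hψ.1 p hp).tendsto
    rw [hψ.2.2.1] at h1
    exact h1.comp (tendsto_nhdsWithin_iff.2 ⟨hlim, Eventually.of_forall fun k =>
      subset_closure (hγΩ k (hR (ball_subset_closedBall hz)))⟩)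
  have hneg : -(c / ((s ^ 2)⁻¹ - (R ^ 2)⁻¹) * ((‖z - a‖ ^ 2)⁻¹ - (R ^ 2)⁻¹)) < 0 :=
    neg_lt_zero.2 (by positivity)
  filter_upwards [hψlim.eventually_const_lt hneg] with k hk
  by_contra! hfar
  refine hk.not_ge ?_
  have hana : ∀ ζ : ℂ, ‖ζ‖ ≤ R → AnalyticAt ℂ (fun ζ : ℂ => γ k (a + ζ • v)) ζ := fun ζ hζ => by
    have hd : DifferentiableOn ℂ (fun ζ : ℂ => γ k (a + ζ • v)) ((fun ζ : ℂ => a + ζ • v) ⁻¹' Ω) :=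
      (hγ k).comp (by fun_prop) (mapsTo_preimage _ _)
    exact hd.analyticAt ((hopen.preimage (by fun_prop)).mem_nhds (hline ζ hζ))
  have hζ : ‖((‖z - a‖ : ℝ) : ℂ)‖ = ‖z - a‖ := by simp
  have hzv : a + ((‖z - a‖ : ℝ) : ℂ) • v = z := by
    rw [hv, smul_smul, ← Complex.ofReal_mul, mul_inv_cancel₀ hza'.ne']
    simp
  have := hψ.2.1.comp_le_of_le_on_closedBall hopen (hψ.1.mono subset_closure) hψ0 hs hsR hc hana
    (fun ζ hζ => hγΩ k (hline ζ hζ)) (fun ζ hζ => ?_) (hsz.trans_eq hζ.symm) (hζ.trans_le hzR.le)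
  · rwa [hζ, hzv] at this
  · have hζR := hζ.trans_lt hsR
    refine hcψ _ (hγΩ k (hline ζ hζR.le)) ?_
    have hda : dist (a + ζ • v) a = ‖ζ‖ := by simp [norm_smul, hvn]
    have h1 : dist (γ k (a + ζ • v)) (γ k a) ≤ D / R * dist (a + ζ • v) a :=
      Complex.dist_le_div_mul_dist_of_mapsTo_ball
        ((hγ k).mono (ball_subset_closedBall.trans hR))
        (fun x hx => hD (hγΩ k (hR (ball_subset_closedBall hx))) (hγΩ k haΩ))
        (by rw [mem_ball, hda]; exact hζR)
    have h2 : D / R * dist (a + ζ • v) a ≤ D / R * s := by rw [hda]; gcongr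
    have h3 := dist_triangle_left (γ k a) p (γ k (a + ζ • v))
    linarith

end Barrier

/-- **Proposition 3.** Let `Ω` be a bounded domain in `ℂⁿ` which has a barrier at some
point `p ∈ ∂Ω`. Let `q ∈ Ω` and let `γ_k` be automorphisms of `Ω` with `γ_k(q) → p` as
`k → ∞`. Then `γ_k(z) → p` uniformly on compact subsets of `Ω`. -/
theorem tendsto_uniformly_of_barrier (n : ℕ)
    (Ω : Set (EuclideanSpace ℂ (Fin n)))
    (hopen : IsOpen Ω) (hconn : IsConnected Ω) (hbdd : Bornology.IsBounded Ω)
    (p : EuclideanSpace ℂ (Fin n)) (hp : p ∈ frontier Ω)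
    (ψ : EuclideanSpace ℂ (Fin n) → ℝ) (hψ : IsBarrierAt Ω p ψ)
    (q : EuclideanSpace ℂ (Fin n)) (hq : q ∈ Ω)
    (γ : ℕ → EuclideanSpace ℂ (Fin n) → EuclideanSpace ℂ (Fin n))
    (hγ : ∀ k, IsAutOn Ω (γ k))
    (htend : Tendsto (fun k => γ k q) atTop (𝓝 p)) :
    ∀ K : Set (EuclideanSpace ℂ (Fin n)), K ⊆ Ω → IsCompact K →
      TendstoUniformlyOn (fun k z => γ k z) (fun _ => p) atTop K := by
  have hp' : p ∈ closure Ω := frontier_subset_closure hp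
  have hdiff : ∀ k, DifferentiableOn ℂ (γ k) Ω := fun k => (hγ k).1
  have hmaps : ∀ k, MapsTo (γ k) Ω Ω := fun k => (hγ k).2.1
  have hball : ∀ a ∈ Ω, ∃ R > 0, closedBall a R ⊆ Ω := fun a ha =>
    Metric.nhds_basis_closedBall.mem_iff.1 (hopen.mem_nhds ha)
  -- the points pushed to `p` form a nonempty, open and relatively closed subset of `Ω`
  have hpt : Ω ⊆ interior {z | Tendsto (fun k => γ k z) atTop (𝓝 p)} := by
    have hnhds : ∀ z ∈ Ω, Tendsto (fun k => γ k z) atTop (𝓝 p) →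
        z ∈ interior {z | Tendsto (fun k => γ k z) atTop (𝓝 p)} := by
      intro z hz hzp
      obtain ⟨R, hR, hRΩ⟩ := hball z hz
      rw [mem_interior_iff_mem_nhds]
      filter_upwards [ball_mem_nhds z (half_pos hR)] with a ha
      refine hψ.tendsto_center hopen hbdd hp' hdiff hmaps (R := R / 2)
        (Subset.trans (closedBall_subset_closedBall' ?_) hRΩ) (mem_ball_comm.1 ha) hzp
      linarith [mem_ball.1 ha]
    refine hconn.isPreconnected.subset_of_closure_inter_subset isOpen_interior
      ⟨q, hq, hnhds q hq htend⟩ ?_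
    rintro a ⟨hacl, ha⟩
    obtain ⟨R, hR, hRΩ⟩ := hball a ha
    obtain ⟨z, hz, hza⟩ := Metric.mem_closure_iff.1 hacl R hR
    exact hnhds a ha (hψ.tendsto_center hopen hbdd hp' hdiff hmaps hRΩ (mem_ball'.2 hza)
      (interior_subset hz))
  intro K hK hKc
  rw [← tendstoLocallyUniformlyOn_iff_tendstoUniformlyOn_of_compact hKc,
    Metric.tendstoLocallyUniformlyOn_iff]
  intro ε hε a ha
  obtain ⟨R, hR, hRΩ⟩ := hball a (hK ha)
  obtain ⟨D, hD⟩ := Metric.isBounded_iff.1 hbdd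
  have hnear : ∀ᶠ x in 𝓝 a, D / R * dist x a < ε / 2 := by
    have : Continuous fun x => D / R * dist x a := by fun_prop
    exact (this.tendsto a).eventually_lt_const (by simpa using half_pos hε)
  refine ⟨_, mem_nhdsWithin_of_mem_nhds (hnear.and (ball_mem_nhds a hR)), ?_⟩
  have hpa : Tendsto (fun k => γ k a) atTop (𝓝 p) := interior_subset (hpt (hK ha))
  filter_upwards [Metric.tendsto_nhds.1 hpa (ε / 2) (half_pos hε)] with k hk x hx
  have hL : dist (γ k x) (γ k a) ≤ D / R * dist x a :=
    Complex.dist_le_div_mul_dist_of_mapsTo_ball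
      ((hdiff k).mono (ball_subset_closedBall.trans hRΩ))
      (fun y hy => hD (hmaps k (hRΩ (ball_subset_closedBall hy))) (hmaps k (hK ha))) hx.2
  have hx1 : D / R * dist x a < ε / 2 := hx.1
  rw [dist_comm]
  linarith [dist_triangle (γ k x) (γ k a) p]

end
end

section
/- Let γ ∈ Aut(Δ) generate a properly discontinuous cyclic group Γ = {γ^k : k ∈ ℤ} of automorphisms of the unit disc Δ. Then ∑_{γ'∈Γ} (1 − |γ'(0)|) < ∞, i.e., ∑_{k∈ℤ} (1 − |γ^k(0)|) < ∞. -/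
open Set Metric Filter MeasureTheory Topology

noncomputable section

variable {E : Type*} [NormedAddCommGroup E] [NormedSpace ℂ E]

open ComplexConjugate in
/-- The Möbius transformation with matrix `[[p̄, q̄], [q, p]]`. -/
def discMobius (p q z : ℂ) : ℂ := (conj p * z + conj q) / (q * z + p)

open ComplexConjugate in
theorem one_sub_conj_mul_ne_zero {a z : ℂ} (ha : ‖a‖ < 1) (hz : ‖z‖ < 1) :
    1 - conj a * z ≠ 0 := by
  intro h
  have h1 : ‖conj a * z‖ = 1 := by rw [← sub_eq_zero.mp h, norm_one]
  rw [norm_mul, RCLike.norm_conj] at h1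
  nlinarith [norm_nonneg a, norm_nonneg z]

theorem mul_add_ne_zero_of_normSq_sub {p q z : ℂ}
    (h : Complex.normSq p - Complex.normSq q = 1) (hz : ‖z‖ < 1) : q * z + p ≠ 0 := by
  intro h0
  have h1 : Complex.normSq p = Complex.normSq q * Complex.normSq z := by
    rw [eq_neg_of_add_eq_zero_right h0, Complex.normSq_neg, Complex.normSq_mul]
  have h2 : Complex.normSq z < 1 := by
    rw [Complex.normSq_eq_norm_sq]
    nlinarith [norm_nonneg z]
  nlinarith [Complex.normSq_nonneg q]

open ComplexConjugate in
/-- The Blaschke factor: the disc automorphism sending `a` to `0`. -/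
def blaschke (a z : ℂ) : ℂ := (z - a) / (1 - conj a * z)

theorem norm_blaschke_lt_one {a z : ℂ} (ha : ‖a‖ < 1) (hz : ‖z‖ < 1) : ‖blaschke a z‖ < 1 := by
  have hne := one_sub_conj_mul_ne_zero ha hz
  rw [blaschke, norm_div, div_lt_one (norm_pos_iff.mpr hne)]
  apply lt_of_pow_lt_pow_left₀ 2 (norm_nonneg _)
  rw [← sq_lt_one_iff₀ (norm_nonneg _), ← Complex.normSq_eq_norm_sq, Complex.normSq_apply] at ha hz
  simp only [← Complex.normSq_eq_norm_sq, Complex.normSq_apply, Complex.sub_re, Complex.sub_im,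
    Complex.mul_re, Complex.mul_im, Complex.conj_re, Complex.conj_im, Complex.one_re,
    Complex.one_im]
  nlinarith [mul_pos (sub_pos.mpr ha) (sub_pos.mpr hz)]

open ComplexConjugate in
theorem blaschke_neg_blaschke {a z : ℂ} (ha : ‖a‖ < 1) (hz : ‖z‖ < 1) :
    blaschke (-a) (blaschke a z) = z := by
  have h1 := one_sub_conj_mul_ne_zero ha hz
  have h2 := one_sub_conj_mul_ne_zero (a := -a) (by rwa [norm_neg]) (norm_blaschke_lt_one ha hz)
  have hb : blaschke a z * (1 - conj a * z) = z - a := div_mul_cancel₀ _ h1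
  rw [blaschke, div_eq_iff h2, map_neg]
  linear_combination hb

theorem differentiableOn_blaschke {a : ℂ} (ha : ‖a‖ < 1) :
    DifferentiableOn ℂ (blaschke a) (ball 0 1) := by
  unfold blaschke
  refine DifferentiableOn.div (by fun_prop) (by fun_prop) fun z hz => ?_
  exact one_sub_conj_mul_ne_zero ha (mem_ball_zero_iff.mp hz)

/-- A disc automorphism fixing the origin is a rotation. -/
theorem eq_mul_of_disc_aut_of_map_zero {h k : ℂ → ℂ}
    (hd : DifferentiableOn ℂ h (ball 0 1)) (kd : DifferentiableOn ℂ k (ball 0 1))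
    (hm : MapsTo h (ball 0 1) (ball 0 1)) (km : MapsTo k (ball 0 1) (ball 0 1))
    (hkh : ∀ z ∈ ball (0 : ℂ) 1, k (h z) = z) (h0 : h 0 = 0) :
    ∃ c : ℂ, ‖c‖ = 1 ∧ ∀ z ∈ ball (0 : ℂ) 1, h z = c * z := by
  have k0 : k 0 = 0 := by simpa [h0] using hkh 0 (by simp)
  have hm' := hm.mono_right (ball_subset_closedBall (x := (0 : ℂ)) (ε := 1))
  have hw : (1 / 2 : ℂ) ∈ ball (0 : ℂ) 1 := by simp; norm_num
  have hnorm : ‖h (1 / 2)‖ = ‖(1 / 2 : ℂ)‖ := by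
    apply le_antisymm
    · exact Complex.norm_le_norm_of_mapsTo_ball hd hm' h0 (mem_ball_zero_iff.mp hw)
    · simpa only [hkh _ hw] using Complex.norm_le_norm_of_mapsTo_ball kd
        (km.mono_right ball_subset_closedBall) k0 (mem_ball_zero_iff.mp (hm hw))
  obtain ⟨c, hc, hEq⟩ := Complex.affine_of_mapsTo_ball_of_exists_norm_dslope_eq_div'
    (R₂ := 1) hd (by rwa [h0]) ⟨1 / 2, hw, by
      rw [dslope_of_ne _ (by norm_num), slope_def_field, norm_div, h0, sub_zero, sub_zero, hnorm]
      norm_num⟩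
  refine ⟨c, by simpa using hc, fun z hz => ?_⟩
  simp [hEq hz, h0, mul_comm]

open ComplexConjugate in
/-- Every automorphism of the unit disc is a Möbius transformation. -/
theorem IsAutOn.exists_eq_discMobius {f : ℂ → ℂ} (hf : IsAutOn (ball (0 : ℂ) 1) f) :
    ∃ p q : ℂ, Complex.normSq p - Complex.normSq q = 1 ∧
      ∀ z ∈ ball (0 : ℂ) 1, f z = discMobius p q z := by
  obtain ⟨fd, fm, g, gd, gm, hgf, hfg⟩ := hf
  set a := g 0
  have ha : ‖a‖ < 1 := mem_ball_zero_iff.mp (gm (by simp))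
  have ha' : ‖-a‖ < 1 := by rwa [norm_neg]
  have bm : ∀ {b : ℂ}, ‖b‖ < 1 → MapsTo (blaschke b) (ball 0 1) (ball 0 1) := fun hb z hz =>
    mem_ball_zero_iff.mpr (norm_blaschke_lt_one hb (mem_ball_zero_iff.mp hz))
  have hfa : f a = 0 := hfg (by simp : (0 : ℂ) ∈ ball (0 : ℂ) 1)
  obtain ⟨c, hc, hEq⟩ := eq_mul_of_disc_aut_of_map_zero
    (fd.comp (differentiableOn_blaschke ha') (bm ha'))
    ((differentiableOn_blaschke ha).comp gd gm) (fm.comp (bm ha')) ((bm ha).comp gm)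
    (fun z hz => by
      have h1 : g (f (blaschke (-a) z)) = blaschke (-a) z := hgf (bm ha' hz)
      simp only [Function.comp_apply, h1]
      simpa using blaschke_neg_blaschke ha' (mem_ball_zero_iff.mp hz))
    (by simp [blaschke, hfa])
  obtain ⟨s, hs⟩ := IsAlgClosed.exists_pow_nat_eq c two_pos
  have hs1 : ‖s‖ = 1 := by
    have : ‖s‖ ^ 2 = 1 := by rw [← norm_pow, hs, hc]
    exact (pow_eq_one_iff_of_nonneg (norm_nonneg s) two_ne_zero).mp this
  have hss : s * conj s = 1 := by
    rw [Complex.mul_conj, Complex.normSq_eq_norm_sq, hs1]; simp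
  have hpos : 0 < 1 - Complex.normSq a := by
    rw [Complex.normSq_eq_norm_sq]; nlinarith [norm_nonneg a]
  set l : ℝ := (√(1 - Complex.normSq a))⁻¹ with hl
  have hl0 : l ≠ 0 := inv_ne_zero (Real.sqrt_ne_zero'.mpr hpos)
  have hl2 : l * l * (1 - Complex.normSq a) = 1 := by
    rw [hl, ← mul_inv, Real.mul_self_sqrt hpos.le, inv_mul_cancel₀ hpos.ne']
  refine ⟨l * conj s, -(l * conj s * conj a), ?_, fun z hz => ?_⟩
  · have hns : Complex.normSq s = 1 := by rw [Complex.normSq_eq_norm_sq, hs1, one_pow]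
    simp only [Complex.normSq_neg, Complex.normSq_mul, Complex.normSq_conj, Complex.normSq_ofReal,
      hns]
    linarith
  · have h1 : f z = c * blaschke a z := by
      simpa [blaschke_neg_blaschke ha (mem_ball_zero_iff.mp hz)] using hEq _ (bm ha hz)
    have hne := one_sub_conj_mul_ne_zero ha (mem_ball_zero_iff.mp hz)
    have hlc : (l : ℂ) ≠ 0 := Complex.ofReal_ne_zero.mpr hl0
    have hsc : conj s ≠ 0 := right_ne_zero_of_mul_eq_one hss
    have hden : -(l * conj s * conj a) * z + l * conj s = l * conj s * (1 - conj a * z) := by ring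
    rw [h1, discMobius, hden, blaschke, ← hs, mul_div_assoc', div_eq_div_iff hne
      (mul_ne_zero (mul_ne_zero hlc hsc) hne)]
    simp only [map_mul, map_neg, Complex.conj_conj, Complex.conj_ofReal]
    linear_combination (l * s * (z - a) * (1 - conj a * z)) * hss

open ComplexConjugate in
theorem eq_discMobius_of_leftInverse {f g : ℂ → ℂ} {p q : ℂ}
    (h : Complex.normSq p - Complex.normSq q = 1)
    (hf : ∀ z ∈ ball (0 : ℂ) 1, f z = discMobius p q z)
    (gm : MapsTo g (ball 0 1) (ball 0 1)) (hfg : EqOn (f ∘ g) id (ball 0 1))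
    {w : ℂ} (hw : w ∈ ball (0 : ℂ) 1) : g w = discMobius (conj p) (-q) w := by
  have h1 : discMobius p q (g w) = w := (hf _ (gm hw)).symm.trans (hfg hw)
  have hne := mul_add_ne_zero_of_normSq_sub h (mem_ball_zero_iff.mp (gm hw))
  have hne' : -q * w + conj p ≠ 0 := mul_add_ne_zero_of_normSq_sub
    (by simpa using h) (mem_ball_zero_iff.mp hw)
  rw [discMobius, div_eq_iff hne] at h1
  rw [discMobius, eq_div_iff hne', Complex.conj_conj, map_neg]
  linear_combination h1

/-- The Lucas sequence `0, 1, t, t² - 1, …` of powers of a matrix with determinant one and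
trace `t`. -/
def lucasU (t : ℝ) : ℕ → ℝ
  | 0 => 0
  | 1 => 1
  | n + 2 => t * lucasU t (n + 1) - lucasU t n

theorem lucasU_invariant (t : ℝ) (n : ℕ) :
    lucasU t (n + 1) ^ 2 - t * lucasU t (n + 1) * lucasU t n + lucasU t n ^ 2 = 1 := by
  induction n with
  | zero => simp [lucasU]
  | succ n ih =>
    rw [show lucasU t (n + 1 + 1) = t * lucasU t (n + 1) - lucasU t n from rfl]
    linear_combination ih

theorem lucasU_sq_le {t : ℝ} (ht : |t| < 2) (n : ℕ) :
    lucasU t n ^ 2 ≤ (1 - t ^ 2 / 4)⁻¹ := by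
  have hpos : 0 < 1 - t ^ 2 / 4 := by
    nlinarith [sq_abs t, abs_nonneg t]
  rw [← one_div, le_div_iff₀ hpos]
  nlinarith [lucasU_invariant t n, sq_nonneg (lucasU t (n + 1) - t / 2 * lucasU t n)]

theorem abs_lucasU_add_one_le {t : ℝ} (ht : 2 ≤ |t|) (n : ℕ) :
    |lucasU t n| + 1 ≤ |lucasU t (n + 1)| := by
  induction n with
  | zero => simp [lucasU]
  | succ n ih =>
    have h1 : |t * lucasU t (n + 1)| - |lucasU t n| ≤ |lucasU t (n + 1 + 1)| :=
      abs_sub_abs_le_abs_sub _ _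
    rw [abs_mul] at h1
    nlinarith [abs_nonneg (lucasU t (n + 1))]

theorem natCast_le_abs_lucasU {t : ℝ} (ht : 2 ≤ |t|) (n : ℕ) : (n : ℝ) ≤ |lucasU t n| := by
  induction n with
  | zero => simp
  | succ n ih => push_cast; linarith [abs_lucasU_add_one_le ht n]

theorem normSq_mul_lucasU_sub {p q : ℂ} (h : Complex.normSq p - Complex.normSq q = 1) (n : ℕ) :
    Complex.normSq (p * lucasU (2 * p.re) (n + 1) - lucasU (2 * p.re) n) =
      1 + Complex.normSq q * lucasU (2 * p.re) (n + 1) ^ 2 := by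
  have h1 := lucasU_invariant (2 * p.re) n
  simp only [Complex.normSq_apply] at h
  simp only [Complex.normSq_apply, Complex.sub_re, Complex.sub_im, Complex.mul_re, Complex.mul_im,
    Complex.ofReal_re, Complex.ofReal_im]
  linear_combination h1 + lucasU (2 * p.re) (n + 1) ^ 2 * h

open ComplexConjugate in
theorem iterate_discMobius_zero {f : ℂ → ℂ} {p q : ℂ}
    (h : Complex.normSq p - Complex.normSq q = 1) (fm : MapsTo f (ball 0 1) (ball 0 1))
    (hf : ∀ z ∈ ball (0 : ℂ) 1, f z = discMobius p q z) (n : ℕ) :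
    f^[n + 1] 0 = conj q * lucasU (2 * p.re) (n + 1) /
      (p * lucasU (2 * p.re) (n + 1) - lucasU (2 * p.re) n) := by
  induction n with
  | zero => simp [hf 0 (by simp), discMobius, lucasU]
  | succ n ih =>
    have hne : ∀ m, p * lucasU (2 * p.re) (m + 1) - lucasU (2 * p.re) m ≠ 0 := fun m => by
      rw [← Complex.normSq_pos, normSq_mul_lucasU_sub h]
      have := Complex.normSq_nonneg q
      positivity
    have hmem : f^[n + 1] 0 ∈ ball (0 : ℂ) 1 := fm.iterate (n + 1) (by simp)
    have hden := mul_add_ne_zero_of_normSq_sub h (mem_ball_zero_iff.mp hmem)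
    have hpq : p * conj p - q * conj q = 1 := by
      rw [Complex.mul_conj, Complex.mul_conj, ← Complex.ofReal_sub, h, Complex.ofReal_one]
    have htr : ((2 * p.re : ℝ) : ℂ) = p + conj p := (Complex.add_conj p).symm
    have hrec : (lucasU (2 * p.re) (n + 1 + 1) : ℂ) =
        (p + conj p) * lucasU (2 * p.re) (n + 1) - lucasU (2 * p.re) n := by
      rw [← htr, ← Complex.ofReal_mul, ← Complex.ofReal_sub]; rfl
    rw [Function.iterate_succ_apply', hf _ hmem, discMobius, div_eq_div_iff hden (hne _), hrec]
    rw [eq_div_iff (hne n)] at ih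
    linear_combination ih + f^[n + 1] 0 *
      ((p + conj p) * lucasU (2 * p.re) (n + 1) - lucasU (2 * p.re) n) * hpq

theorem one_sub_norm_sq_iterate_zero {f : ℂ → ℂ} {p q : ℂ}
    (h : Complex.normSq p - Complex.normSq q = 1) (fm : MapsTo f (ball 0 1) (ball 0 1))
    (hf : ∀ z ∈ ball (0 : ℂ) 1, f z = discMobius p q z) (n : ℕ) :
    1 - ‖f^[n] 0‖ ^ 2 = (1 + Complex.normSq q * lucasU (2 * p.re) n ^ 2)⁻¹ := by
  cases n with
  | zero => simp [lucasU]
  | succ n =>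
    have hpos : 0 < 1 + Complex.normSq q * lucasU (2 * p.re) (n + 1) ^ 2 := by
      have := Complex.normSq_nonneg q
      positivity
    rw [← Complex.normSq_eq_norm_sq, iterate_discMobius_zero h fm hf, Complex.normSq_div,
      normSq_mul_lucasU_sub h, Complex.normSq_mul, Complex.normSq_conj, Complex.normSq_ofReal]
    field_simp
    ring

open ComplexConjugate in
theorem one_sub_norm_sq_zIter_zero {f g : ℂ → ℂ} {p q : ℂ}
    (h : Complex.normSq p - Complex.normSq q = 1) (fm : MapsTo f (ball 0 1) (ball 0 1))
    (gm : MapsTo g (ball 0 1) (ball 0 1)) (hfg : EqOn (f ∘ g) id (ball 0 1))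
    (hf : ∀ z ∈ ball (0 : ℂ) 1, f z = discMobius p q z) (k : ℤ) :
    1 - ‖zIter f g k 0‖ ^ 2 = (1 + Complex.normSq q * lucasU (2 * p.re) k.natAbs ^ 2)⁻¹ := by
  cases k with
  | ofNat n => exact one_sub_norm_sq_iterate_zero h fm hf n
  | negSucc n =>
    simpa [zIter] using one_sub_norm_sq_iterate_zero (p := conj p) (q := -q) (by simpa using h) gm
      (fun w hw => eq_discMobius_of_leftInverse h hf gm hfg hw) (n + 1)

theorem summable_inv_one_add_mul_lucasU_sq {b t : ℝ} (hb : 0 < b) (ht : 2 ≤ |t|) :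
    Summable fun k : ℤ => (1 + b * lucasU t k.natAbs ^ 2)⁻¹ := by
  have hnat : Summable fun n : ℕ => (1 + b * lucasU t n ^ 2)⁻¹ := by
    rw [← summable_nat_add_iff 1]
    have hs : Summable fun n : ℕ => b⁻¹ * (1 / ((n + 1 : ℕ) : ℝ) ^ 2) :=
      ((summable_nat_add_iff 1).mpr
        (Real.summable_one_div_nat_pow.mpr one_lt_two)).mul_left b⁻¹
    refine hs.of_nonneg_of_le (fun n => by positivity) fun n => ?_
    rw [one_div, ← mul_inv]
    have hle : ((n + 1 : ℕ) : ℝ) ^ 2 ≤ lucasU t (n + 1) ^ 2 := by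
      rw [← sq_abs (lucasU t (n + 1))]
      exact pow_le_pow_left₀ (Nat.cast_nonneg _) (natCast_le_abs_lucasU ht (n + 1)) 2
    apply inv_anti₀ (by positivity)
    nlinarith
  exact Summable.of_nat_of_neg (by simpa using hnat) (by simpa using hnat)

theorem ProperlyDiscontinuousOn.finite_of_norm_apply_zero_le {Γ : Set (ℂ → ℂ)}
    (hpd : ProperlyDiscontinuousOn (ball (0 : ℂ) 1) Γ) {r : ℝ} (hr : r < 1)
    (hle : ∀ γ ∈ Γ, ‖γ 0‖ ≤ r) : Γ.Finite := by
  refine (hpd {0} (closedBall 0 r) (by simp) (closedBall_subset_ball hr) isCompact_singleton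
    (isCompact_closedBall 0 r)).subset fun γ hγ => ⟨hγ, γ 0, ?_, ?_⟩
  · exact mem_image_of_mem γ rfl
  · exact mem_closedBall_zero_iff.mpr (hle γ hγ)

/-- **Proposition 4.** Every cyclic, properly discontinuous group `Γ = {γ^k : k ∈ ℤ}` of
automorphisms of the unit disc `Δ` satisfies `∑_{γ' ∈ Γ} (1 - |γ'(0)|) < ∞`.
(The elements of `Γ` are required to be pairwise distinct as automorphisms of `Δ`, so
that the sum over the group is counted without repetition.) -/
theorem cyclic_disc_group_summable (Γ : Set (ℂ → ℂ))
    (hgrp : IsAutGroupOn (ball (0 : ℂ) 1) Γ)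
    (hcyc : IsCyclicAutGroupOn (ball (0 : ℂ) 1) Γ)
    (hpd : ProperlyDiscontinuousOn (ball (0 : ℂ) 1) Γ)
    (hfaithful : ∀ γ ∈ Γ, ∀ σ ∈ Γ, EqOn γ σ (ball (0 : ℂ) 1) → γ = σ) :
    Summable fun γ : Γ => 1 - ‖γ.1 0‖ := by
  obtain ⟨γ, hγ, γ', hγ', -, hinv, -, hgen⟩ := hcyc
  obtain ⟨p, q, hpq, hmob⟩ := (hgrp.aut γ hγ).exists_eq_discMobius
  choose! e he using hgen
  have hnorm : ∀ σ ∈ Γ, 1 - ‖σ 0‖ ^ 2 =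
      (1 + Complex.normSq q * lucasU (2 * p.re) (e σ).natAbs ^ 2)⁻¹ := fun σ hσ => by
    rw [he σ hσ (mem_ball_self one_pos), one_sub_norm_sq_zIter_zero hpq (hgrp.aut γ hγ).2.1
      (hgrp.aut γ' hγ').2.1 hinv hmob]
  have hlt : ∀ σ ∈ Γ, ‖σ 0‖ < 1 := fun σ hσ =>
    mem_ball_zero_iff.mp ((hgrp.aut σ hσ).2.1 (mem_ball_self one_pos))
  by_cases hbdd : ∃ M, ∀ n, Complex.normSq q * lucasU (2 * p.re) n ^ 2 ≤ M
  · obtain ⟨M, hM⟩ := hbdd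
    have hM0 : 0 ≤ M := by simpa [lucasU] using hM 0
    have hfin : Γ.Finite := by
      refine hpd.finite_of_norm_apply_zero_le (r := √(1 - (1 + M)⁻¹)) ?_ fun σ hσ => ?_
      · rw [Real.sqrt_lt' one_pos]
        linarith [inv_pos.mpr (by linarith : 0 < 1 + M)]
      · apply Real.le_sqrt_of_sq_le
        have hnn := mul_nonneg (Complex.normSq_nonneg q)
          (sq_nonneg (lucasU (2 * p.re) (e σ).natAbs))
        have := inv_anti₀ (by linarith) (add_le_add_right (hM (e σ).natAbs) 1)
        linarith [hnorm σ hσ]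
    have := hfin.to_subtype
    exact Summable.of_finite
  · have hq : 0 < Complex.normSq q := by
      refine (Complex.normSq_nonneg q).lt_of_ne fun h0 => hbdd ⟨0, fun n => ?_⟩
      simp [← h0]
    have ht : 2 ≤ |2 * p.re| := by
      by_contra! ht
      exact hbdd ⟨_, fun n => mul_le_mul_of_nonneg_left (lucasU_sq_le ht n) hq.le⟩
    have hinj : Function.Injective fun σ : Γ => e σ := fun σ τ hστ => by
      refine Subtype.ext (hfaithful _ σ.2 _ τ.2 fun z hz => ?_)
      rw [he _ σ.2 hz, he _ τ.2 hz]
      exact congrArg (fun k => zIter γ γ' k z) hστ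
    refine ((summable_inv_one_add_mul_lucasU_sq hq ht).comp_injective hinj).of_nonneg_of_le
      (fun σ => sub_nonneg.mpr (hlt _ σ.2).le) fun σ => ?_
    rw [Function.comp_apply, ← hnorm _ σ.2]
    nlinarith [hlt _ σ.2, norm_nonneg (σ.1 0)]

end
end

section
/- Let γ be an automorphism of the unit ball B ⊂ ℂⁿ, q ∈ B, and suppose there is a strictly increasing sequence of integers k_j such that γ^{k_j}(q) converges to a point p ∈ ∂B. Then p is a fixed point of the continuous extension of γ to the closed ball: γ(p) = p. -/
open Set Metric Filter MeasureTheory Topology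

noncomputable section

variable {E : Type*} [NormedAddCommGroup E] [NormedSpace ℂ E]

/-- **Harnack's inequality** for a holomorphic function `F` with positive real part on a ball:
its oscillation between the centre `c` and a point `z` is controlled by `Re (F c)` and by
`Re (F z)`. -/
theorem norm_sub_le_of_re_pos_on_ball {F : E → ℂ} {c z : E} {R : ℝ}
    (hd : DifferentiableOn ℂ F (ball c R)) (hpos : ∀ x ∈ ball c R, 0 < (F x).re)
    (hz : z ∈ ball c R) :
    (1 - dist z c / R) * ‖F z - F c‖ ≤ dist z c / R * (2 * (F c).re) ∧
      (1 - dist z c / R) * ‖F z - F c‖ ≤ dist z c / R * (2 * (F z).re) := by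
  have hR : 0 < R := nonempty_ball.1 ⟨z, hz⟩
  have hc : c ∈ ball c R := mem_ball_self hR
  have hne : ∀ x ∈ ball c R, F x + (starRingEnd ℂ) (F c) ≠ 0 := fun x hx h => by
    have := congrArg Complex.re h
    simp only [Complex.add_re, Complex.conj_re, Complex.zero_re] at this
    linarith [hpos x hx, hpos c hc]
  have hschwarz := Complex.dist_le_div_mul_dist_of_mapsTo_ball
    (f := fun x => (F x - F c) / (F x + (starRingEnd ℂ) (F c))) (R₂ := 1)
    (by simpa only [div_eq_mul_inv] using (hd.sub_const (F c)).fun_mul ((hd.add_const _).fun_inv hne))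
    (fun x hx => by
      simp only [sub_self, zero_div, mem_closedBall_zero_iff, norm_div]
      refine div_le_one_of_le₀ ?_ (norm_nonneg _)
      rw [← sq_le_sq₀ (norm_nonneg _) (norm_nonneg _), Complex.sq_norm, Complex.sq_norm,
        Complex.normSq_apply, Complex.normSq_apply]
      simp only [Complex.sub_re, Complex.sub_im, Complex.add_re, Complex.add_im,
        Complex.conj_re, Complex.conj_im]
      nlinarith [mul_pos (hpos x hx) (hpos c hc)]) hz
  simp only [sub_self, zero_div, dist_zero_right, norm_div] at hschwarz
  rw [div_le_iff₀ (norm_pos_iff.2 (hne z hz)), one_div_mul_eq_div] at hschwarz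
  have hρ : 0 ≤ dist z c / R := by positivity
  have h₁ : ‖F z + (starRingEnd ℂ) (F c)‖ ≤ ‖F z - F c‖ + 2 * (F c).re := by
    have : F z + (starRingEnd ℂ) (F c) = (F z - F c) + ((2 * (F c).re : ℝ) : ℂ) := by
      rw [← Complex.add_conj]; ring
    rw [this]
    refine (norm_add_le _ _).trans_eq ?_
    rw [Complex.norm_of_nonneg (by linarith [hpos c hc])]
  have h₂ : ‖F z + (starRingEnd ℂ) (F c)‖ ≤ ‖F z - F c‖ + 2 * (F z).re := by
    have : F z + (starRingEnd ℂ) (F c) =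
        ((2 * (F z).re : ℝ) : ℂ) - (starRingEnd ℂ) (F z - F c) := by
      rw [← Complex.add_conj, map_sub]; ring
    rw [this]
    refine (norm_sub_le _ _).trans_eq ?_
    rw [Complex.norm_of_nonneg (by linarith [hpos z hz]), RCLike.norm_conj, add_comm]
  constructor
  · nlinarith [mul_le_mul_of_nonneg_left h₁ hρ]
  · nlinarith [mul_le_mul_of_nonneg_left h₂ hρ]

/-- If holomorphic functions `F i` have positive real parts on a ball, then `Re (F i)` tends to
zero at the centre if and only if it does so at any given point of the ball. -/
theorem tendsto_re_zero_iff_of_re_pos_on_ball {ι : Type*} {l : Filter ι} {F : ι → E → ℂ}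
    {c z : E} {R : ℝ} (hd : ∀ i, DifferentiableOn ℂ (F i) (ball c R))
    (hpos : ∀ i, ∀ x ∈ ball c R, 0 < (F i x).re) (hz : z ∈ ball c R) :
    Tendsto (fun i => (F i c).re) l (𝓝 0) ↔ Tendsto (fun i => (F i z).re) l (𝓝 0) := by
  have hR : 0 < R := nonempty_ball.1 ⟨z, hz⟩
  have hρ : 0 < 1 - dist z c / R := by
    rw [sub_pos, div_lt_one hR]; exact hz
  have key : ∀ u : ι → ℝ, (∀ i, (1 - dist z c / R) * ‖F i z - F i c‖ ≤
      dist z c / R * (2 * u i)) → Tendsto u l (𝓝 0) →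
      Tendsto (fun i => (F i z).re - (F i c).re) l (𝓝 0) := by
    intro u hu ht
    refine squeeze_zero_norm (a := fun i => (dist z c / R * (2 * u i)) / (1 - dist z c / R))
      (fun i => ?_) ?_
    · rw [le_div_iff₀ hρ, mul_comm]
      refine le_trans (mul_le_mul_of_nonneg_left ?_ hρ.le) (hu i)
      simpa using Complex.abs_re_le_norm (F i z - F i c)
    · simpa using ((ht.const_mul 2).const_mul (dist z c / R)).div_const (1 - dist z c / R)
  constructor <;> intro ht
  · simpa using (key _ (fun i => (norm_sub_le_of_re_pos_on_ball (hd i) (hpos i) hz).1) ht).add ht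
  · simpa using ht.sub (key _ (fun i =>
      (norm_sub_le_of_re_pos_on_ball (hd i) (hpos i) hz).2) ht)

section InnerProduct

variable {V : Type*} [NormedAddCommGroup V] [InnerProductSpace ℂ V]

theorem re_one_sub_inner_pos {p v : V} (hp : ‖p‖ = 1) (hv : v ∈ ball (0 : V) 1) :
    0 < (1 - inner ℂ p v).re := by
  have h₁ := (Complex.re_le_norm (inner ℂ p v)).trans (norm_inner_le_norm p v)
  rw [mem_ball_zero_iff] at hv
  rw [hp, one_mul] at h₁
  simp only [Complex.sub_re, Complex.one_re]
  linarith

/-- In the closed unit ball, convergence to a boundary point `p` is detected by the peak function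
`v ↦ 1 - ⟪p, v⟫`. -/
theorem tendsto_iff_re_one_sub_inner {ι : Type*} {l : Filter ι} {p : V} {v : ι → V}
    (hp : ‖p‖ = 1) (hv : ∀ i, ‖v i‖ ≤ 1) :
    Tendsto v l (𝓝 p) ↔ Tendsto (fun i => (1 - inner ℂ p (v i)).re) l (𝓝 0) := by
  constructor <;> intro ht
  · have hcont : Continuous fun x : V => (1 - inner ℂ p x).re := by fun_prop
    have := (hcont.tendsto p).comp ht
    simpa [Function.comp_def, inner_self_eq_norm_sq_to_K, hp] using this
  · rw [tendsto_iff_norm_sub_tendsto_zero]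
    refine squeeze_zero (fun i => norm_nonneg _)
      (g := fun i => Real.sqrt (2 * (1 - inner ℂ p (v i)).re)) (fun i => ?_) ?_
    · refine Real.le_sqrt_of_sq_le ?_
      rw [norm_sub_rev, norm_sub_sq (𝕜 := ℂ), hp]
      simp only [Complex.sub_re, Complex.one_re, RCLike.re_to_complex]
      nlinarith [hv i, norm_nonneg (v i)]
    · simpa using (ht.const_mul 2).sqrt

/-- If holomorphic maps into the unit ball converge at one point of the unit ball to a boundary
point `p`, they converge to `p` at every point of the ball. -/
theorem tendsto_boundary_of_tendsto_boundary {ι : Type*} {l : Filter ι} {f : ι → E → V} {p : V}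
    (hp : ‖p‖ = 1) (hd : ∀ i, DifferentiableOn ℂ (f i) (ball 0 1))
    (hf : ∀ i, MapsTo (f i) (ball 0 1) (ball 0 1)) {a b : E} (ha : a ∈ ball (0 : E) 1)
    (hb : b ∈ ball (0 : E) 1) (ht : Tendsto (fun i => f i a) l (𝓝 p)) :
    Tendsto (fun i => f i b) l (𝓝 p) := by
  have hnorm : ∀ x ∈ ball (0 : E) 1, ∀ i, ‖f i x‖ ≤ 1 := fun x hx i =>
    (mem_ball_zero_iff.1 (hf i hx)).le
  have hF : ∀ i, DifferentiableOn ℂ (fun x => 1 - inner ℂ p (f i x)) (ball 0 1) := fun i =>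
    ((innerSL ℂ p).differentiable.comp_differentiableOn (hd i)).const_sub 1
  have hpos : ∀ i, ∀ x ∈ ball (0 : E) 1, 0 < (1 - inner ℂ p (f i x)).re := fun i x hx =>
    re_one_sub_inner_pos hp (hf i hx)
  rw [tendsto_iff_re_one_sub_inner hp (hnorm a ha)] at ht
  rw [tendsto_iff_re_one_sub_inner hp (hnorm b hb)]
  exact (tendsto_re_zero_iff_of_re_pos_on_ball hF hpos hb).1
    ((tendsto_re_zero_iff_of_re_pos_on_ball hF hpos ha).2 ht)

end InnerProduct

theorem DifferentiableOn.iterate_of_mapsTo {f : E → E} {s : Set E} (hf : DifferentiableOn ℂ f s)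
    (hs : MapsTo f s s) (m : ℕ) : DifferentiableOn ℂ f^[m] s := by
  induction m with
  | zero => exact differentiableOn_id
  | succ m ih => exact ih.comp hf hs

/-- **Section 8.2.** Let `γ` be an automorphism of the unit ball `B ⊂ ℂⁿ` (with inverse
`g` on `B`), extended continuously to the closed ball. Let `q ∈ B` and suppose there is a
strictly increasing sequence of integers `k_j` such that `γ^{k_j}(q)` converges to a point
`p ∈ ∂B`. Then `p` is a fixed point of the continuous extension of `γ` to the closed
ball: `γ(p) = p`. -/
theorem ball_aut_orbit_limit_is_fixed_point (n : ℕ)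
    (γ g : EuclideanSpace ℂ (Fin n) → EuclideanSpace ℂ (Fin n))
    (hγ : IsAutOn (ball (0 : EuclideanSpace ℂ (Fin n)) 1) γ)
    (hg : MapsTo g (ball (0 : EuclideanSpace ℂ (Fin n)) 1)
      (ball (0 : EuclideanSpace ℂ (Fin n)) 1))
    (hgl : EqOn (g ∘ γ) id (ball (0 : EuclideanSpace ℂ (Fin n)) 1))
    (hgr : EqOn (γ ∘ g) id (ball (0 : EuclideanSpace ℂ (Fin n)) 1))
    (hcont : ContinuousOn γ (closedBall (0 : EuclideanSpace ℂ (Fin n)) 1))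
    (hmaps : MapsTo γ (closedBall (0 : EuclideanSpace ℂ (Fin n)) 1)
      (closedBall (0 : EuclideanSpace ℂ (Fin n)) 1))
    (q : EuclideanSpace ℂ (Fin n)) (hq : q ∈ ball (0 : EuclideanSpace ℂ (Fin n)) 1)
    (p : EuclideanSpace ℂ (Fin n)) (hp : p ∈ sphere (0 : EuclideanSpace ℂ (Fin n)) 1)
    (k : ℕ → ℤ) (hk : StrictMono k)
    (htend : Tendsto (fun j => zIter γ g (k j) q) atTop (𝓝 p)) :
    γ p = p := by
  rw [mem_sphere_zero_iff_norm] at hp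
  have hiter : (fun j => zIter γ g (k j) q) =ᶠ[atTop] fun j => γ^[(k j).toNat] q := by
    have hk_top : Tendsto k atTop atTop :=
      hk.monotone.tendsto_atTop_atTop fun b => by
        refine ⟨(b - k 0).toNat, ?_⟩
        have hlin : ∀ j : ℕ, k 0 + j ≤ k j := fun j => by
          induction j with
          | zero => simp
          | succ j ih => have := hk (Nat.lt_add_one j); push_cast; omega
        have := hlin (b - k 0).toNat
        omega
    filter_upwards [hk_top.eventually_ge_atTop 0] with j hj
    obtain ⟨m, hm⟩ := Int.eq_ofNat_of_zero_le hj
    simp only [hm]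
    rfl
  have hlim := htend.congr' hiter
  have hball : ∀ m, MapsTo γ^[m] (ball 0 1) (ball 0 1) := fun m => hγ.2.1.iterate m
  have hlim' : Tendsto (fun j => γ^[(k j).toNat] (γ q)) atTop (𝓝 p) :=
    tendsto_boundary_of_tendsto_boundary hp (fun j => hγ.1.iterate_of_mapsTo hγ.2.1 _)
      (fun j => hball _) hq (hγ.2.1 hq) hlim
  have hγlim : Tendsto (fun j => γ (γ^[(k j).toNat] q)) atTop (𝓝 (γ p)) :=
    (hcont p (mem_closedBall_zero_iff.2 hp.le)).tendsto.comp
      (tendsto_nhdsWithin_iff.2 ⟨hlim, .of_forall fun j => ball_subset_closedBall (hball _ hq)⟩)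
  refine tendsto_nhds_unique hγlim (hlim'.congr fun j => ?_)
  rw [← Function.iterate_succ_apply, Function.iterate_succ_apply']

end
end

section
/- Let γ ∈ Aut(Δ) be a hyperbolic automorphism of the unit disc, with distinct fixed points ρ₁, ρ₂ on the unit circle and coefficient matrix A = [[p̄, q̄],[q, p]] (|p|² − |q|² = 1) having distinct real eigenvalues λ₁, λ₂ with ratio μ = λ₁/λ₂ > 0, μ ≠ 1. Then for every k ∈ ℤ, γ^k(0) = ρ₁ρ₂(μ^k − 1)/(ρ₁μ^k − ρ₂), and ∑_{k∈ℤ} (1 − |γ^k(0)|²) = ∑_{k∈ℤ} 2(1 − Re(ρ̄₁ρ₂))μ^k/|μ^k − ρ̄₁ρ₂|² < ∞. -/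
open Set Metric Filter MeasureTheory Topology

noncomputable section

variable {E : Type*} [NormedAddCommGroup E] [NormedSpace ℂ E]

/-- The orbit point with multiplier `t`: the preimage of `t * (a / b)` under
`z ↦ (z - a) / (z - b)`. -/
def axisPoint (a b : ℂ) (t : ℝ) : ℂ := a * b * ((t : ℂ) - 1) / (a * (t : ℂ) - b)

lemma mul_ofReal_sub_ne_zero {a b : ℂ} (ha : ‖a‖ = 1) (hb : ‖b‖ = 1) (hab : a ≠ b)
    {t : ℝ} (ht : 0 < t) : a * (t : ℂ) - b ≠ 0 := by
  intro h
  have h' : a * (t : ℂ) = b := sub_eq_zero.mp h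
  have hn := congrArg norm h'
  rw [norm_mul, ha, hb, Complex.norm_real, Real.norm_of_nonneg ht.le, one_mul] at hn
  exact hab (by simpa [hn] using h')

lemma moebius_axisPoint {a b c P Q R S : ℂ} {m t : ℝ} (hc : c ≠ 0) (hab : a - b ≠ 0)
    (ht : a * (t : ℂ) - b ≠ 0)
    (hP : c * P = a - m * b) (hQ : c * Q = a * b * (m - 1))
    (hR : c * R = 1 - m) (hS : c * S = m * a - b) :
    (P * axisPoint a b t + Q) / (R * axisPoint a b t + S) = axisPoint a b (m * t) := by
  rw [← mul_div_mul_left _ _ hc]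
  have hnum : c * (P * axisPoint a b t + Q) =
      a * b * (((m * t : ℝ) : ℂ) - 1) * ((a - b) / (a * (t : ℂ) - b)) := by
    rw [mul_add, ← mul_assoc, hP, hQ, axisPoint]
    push_cast
    field_simp
    ring
  have hden : c * (R * axisPoint a b t + S) =
      (a * ((m * t : ℝ) : ℂ) - b) * ((a - b) / (a * (t : ℂ) - b)) := by
    rw [mul_add, ← mul_assoc, hR, hS, axisPoint]
    push_cast
    field_simp
    ring
  rw [hnum, hden, mul_div_mul_right _ _ (div_ne_zero hab ht), axisPoint]

lemma norm_ofReal_sub_sq {w : ℂ} (hw : ‖w‖ = 1) (t : ℝ) :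
    ‖(t : ℂ) - w‖ ^ 2 = t ^ 2 - 2 * t * w.re + 1 := by
  have h : ‖w‖ ^ 2 = 1 := by rw [hw, one_pow]
  rw [Complex.sq_norm, Complex.normSq_apply] at h ⊢
  simp only [Complex.sub_re, Complex.sub_im, Complex.ofReal_re, Complex.ofReal_im]
  linear_combination h

lemma one_sub_norm_axisPoint_sq {a b : ℂ} (ha : ‖a‖ = 1) (hb : ‖b‖ = 1) {t : ℝ}
    (ht : a * (t : ℂ) - b ≠ 0) :
    1 - ‖axisPoint a b t‖ ^ 2 =
      2 * (1 - ((starRingEnd ℂ) a * b).re) * t / ‖(t : ℂ) - (starRingEnd ℂ) a * b‖ ^ 2 := by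
  have hw : ‖(starRingEnd ℂ) a * b‖ = 1 := by simp [ha, hb]
  have haa : a * (starRingEnd ℂ) a = 1 := by simp [Complex.mul_conj', ha]
  have hfac : a * (t : ℂ) - b = a * ((t : ℂ) - (starRingEnd ℂ) a * b) := by
    linear_combination b * haa
  have hden : ‖a * (t : ℂ) - b‖ = ‖(t : ℂ) - (starRingEnd ℂ) a * b‖ := by
    rw [hfac, norm_mul, ha, one_mul]
  have hpos : ‖(t : ℂ) - (starRingEnd ℂ) a * b‖ ^ 2 ≠ 0 := by
    rw [← hden]
    exact pow_ne_zero 2 (norm_ne_zero_iff.mpr ht)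
  have hnum : ‖(t : ℂ) - 1‖ ^ 2 = t ^ 2 - 2 * t + 1 := by
    simpa using norm_ofReal_sub_sq (w := 1) (by simp) t
  rw [axisPoint, norm_div, norm_mul, norm_mul, ha, hb, one_mul, one_mul, div_pow, hden,
    hnum, eq_div_iff hpos, sub_mul, div_mul_cancel₀ _ hpos, norm_ofReal_sub_sq hw]
  ring

lemma mul_div_norm_ofReal_sub_sq_le {w : ℂ} (hw : ‖w‖ = 1) (hw1 : w.re < 1) {t : ℝ}
    (ht : 0 < t) :
    2 * (1 - w.re) * t / ‖(t : ℂ) - w‖ ^ 2 ≤ 4 * (t / (1 + t ^ 2)) := by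
  have hre : -1 ≤ w.re := by
    have := (abs_le.mp (Complex.abs_re_le_norm w)).1
    rwa [hw] at this
  have hlow : (1 - w.re) / 2 * (1 + t ^ 2) ≤ t ^ 2 - 2 * t * w.re + 1 := by
    nlinarith [mul_nonneg (by linarith : (0 : ℝ) ≤ 1 + w.re) (sq_nonneg (t - 1)),
      mul_nonneg (by linarith : (0 : ℝ) ≤ 1 - w.re) ht.le]
  have hpos : 0 < (1 - w.re) / 2 * (1 + t ^ 2) := by
    have : 0 < 1 - w.re := by linarith
    positivity
  rw [norm_ofReal_sub_sq hw, ← mul_div_assoc, div_le_div_iff₀ (hpos.trans_le hlow) (by positivity)]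
  nlinarith [mul_le_mul_of_nonneg_left hlow ht.le]

lemma summable_zpow_div_one_add_sq {m : ℝ} (hm : 0 < m) (hm1 : m ≠ 1) :
    Summable fun k : ℤ => m ^ k / (1 + (m ^ k) ^ 2) := by
  have hle : ∀ t : ℝ, 0 < t → t / (1 + t ^ 2) ≤ t := fun t ht =>
    div_le_self ht.le (by nlinarith [sq_nonneg t])
  have hinv : ∀ t : ℝ, 0 < t → t / (1 + t ^ 2) = t⁻¹ / (1 + t⁻¹ ^ 2) := fun t ht => by
    field_simp
    ring
  have key : ∀ x : ℝ, 0 < x → x < 1 → Summable fun n : ℕ => x ^ n / (1 + (x ^ n) ^ 2) :=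
    fun x hx hx1 => (summable_geometric_of_lt_one hx.le hx1).of_nonneg_of_le
      (fun n => by positivity) fun n => hle _ (by positivity)
  have hnat : Summable fun n : ℕ => m ^ n / (1 + (m ^ n) ^ 2) := by
    rcases lt_or_gt_of_ne hm1 with h | h
    · exact key m hm h
    · refine (key m⁻¹ (by positivity) (inv_lt_one_of_one_lt₀ h)).congr fun n => ?_
      rw [hinv _ (by positivity), inv_pow, inv_inv]
  refine Summable.of_nat_of_neg (by simpa using hnat) (hnat.congr fun n => ?_)
  rw [hinv _ (by positivity), zpow_neg, zpow_natCast]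

lemma zIter_eq_of_step {F : Type*} [NormedAddCommGroup F] {f g : F → F} {x : ℤ → F}
    (hf : ∀ k, f (x k) = x (k + 1)) (hg : ∀ k, g (x k) = x (k - 1)) (k : ℤ) :
    zIter f g k (x 0) = x k := by
  have hfn : ∀ n : ℕ, f^[n] (x 0) = x n := fun n => by
    induction n with
    | zero => simp
    | succ n ih => rw [Function.iterate_succ_apply', ih, hf]; push_cast; rfl
  have hgn : ∀ n : ℕ, g^[n] (x 0) = x (-n) := fun n => by
    induction n with
    | zero => simp
    | succ n ih => rw [Function.iterate_succ_apply', ih, hg]; congr 1; push_cast; ring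
  cases k with
  | ofNat n => exact hfn n
  | negSucc n => exact hgn (n + 1)

/-- The coefficients of a Möbius map conjugated to `diag(m, 1)` by `[[1, -a], [1, -b]]`. -/
lemma coeffs_of_conj_diag {a b P Q R S m α : ℂ} (hab : a - b ≠ 0)
    (h : α • (!![P, Q; R, S] : Matrix (Fin 2) (Fin 2) ℂ) =
      (!![1, -a; 1, -b] : Matrix (Fin 2) (Fin 2) ℂ)⁻¹ * !![m, 0; 0, 1] * !![1, -a; 1, -b]) :
    α ≠ 0 ∧ α * (a - b) * P = a - m * b ∧ α * (a - b) * Q = a * b * (m - 1) ∧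
      α * (a - b) * R = 1 - m ∧ α * (a - b) * S = m * a - b := by
  have hdet : IsUnit (!![1, -a; 1, -b] : Matrix (Fin 2) (Fin 2) ℂ).det := by
    rw [Matrix.det_fin_two_of, isUnit_iff_ne_zero]
    contrapose! hab
    linear_combination hab
  have hB := congrArg (fun M => (!![1, -a; 1, -b] : Matrix (Fin 2) (Fin 2) ℂ) * M) h
  simp only [Matrix.mul_assoc, Matrix.mul_nonsing_inv_cancel_left _ _ hdet] at hB
  have h00 := congrFun (congrFun hB 0) 0
  have h01 := congrFun (congrFun hB 0) 1
  have h10 := congrFun (congrFun hB 1) 0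
  have h11 := congrFun (congrFun hB 1) 1
  simp [Matrix.mul_apply, Fin.sum_univ_two] at h00 h01 h10 h11
  refine ⟨?_, ?_, ?_, ?_, ?_⟩
  · rintro rfl
    simp at h10
  · linear_combination a * h10 - b * h00
  · linear_combination a * h11 - b * h01
  · linear_combination h10 - h00
  · linear_combination h11 - h01

/-- **Section 4, case (ii)₁ (hyperbolic case).** Let `γ(z) = (p̄z + q̄)/(qz + p)`
(`|p|² - |q|² = 1`) be a hyperbolic automorphism of the unit disc, i.e. `(p + p̄)² > 4`,
with distinct fixed points `ρ₁, ρ₂` on the unit circle, and let `λ₁, λ₂` be the distinct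
real eigenvalues of the coefficient matrix `A = [[p̄, q̄], [q, p]]`, with ratio
`μ = λ₁/λ₂ > 0`, `μ ≠ 1`, normalized (as in the text) by `B⁻¹ diag(μ, 1) B = αA` for the
matrix `B = [[1, -ρ₁], [1, -ρ₂]]` and a scalar `α`. Then for every `k ∈ ℤ`,
`γ^k(0) = ρ₁ρ₂(μ^k - 1)/(ρ₁μ^k - ρ₂)`, and
`∑_{k ∈ ℤ} (1 - |γ^k(0)|²) = ∑_{k ∈ ℤ} 2(1 - Re(ρ̄₁ρ₂))μ^k/|μ^k - ρ̄₁ρ₂|² < ∞`. -/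
theorem hyperbolic_disc_aut_orbit (p q : ℂ)
    (hpq : ‖p‖ ^ 2 - ‖q‖ ^ 2 = 1)
    (hhyp : 4 < (2 * p.re) ^ 2)
    (γ γinv : ℂ → ℂ)
    (hγ : γ = fun z => ((starRingEnd ℂ) p * z + (starRingEnd ℂ) q) / (q * z + p))
    (hγinv : γinv = fun z => (p * z - (starRingEnd ℂ) q) / (-q * z + (starRingEnd ℂ) p))
    (ρ₁ ρ₂ : ℂ) (hρ₁ : ‖ρ₁‖ = 1) (hρ₂ : ‖ρ₂‖ = 1) (hρne : ρ₁ ≠ ρ₂)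
    (hfix₁ : γ ρ₁ = ρ₁) (hfix₂ : γ ρ₂ = ρ₂)
    (lam₁ lam₂ : ℝ)
    (hlam₁ : lam₁ ^ 2 - 2 * p.re * lam₁ + 1 = 0)
    (hlam₂ : lam₂ ^ 2 - 2 * p.re * lam₂ + 1 = 0)
    (hlamne : lam₁ ≠ lam₂)
    (μ : ℝ) (hμ : μ = lam₁ / lam₂) (hμpos : 0 < μ) (hμne : μ ≠ 1)
    (hnorm : ∃ α : ℂ, α • (!![(starRingEnd ℂ) p, (starRingEnd ℂ) q; q, p] :
        Matrix (Fin 2) (Fin 2) ℂ) =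
      (!![1, -ρ₁; 1, -ρ₂] : Matrix (Fin 2) (Fin 2) ℂ)⁻¹ *
        (!![(μ : ℂ), 0; 0, 1] : Matrix (Fin 2) (Fin 2) ℂ) *
        (!![1, -ρ₁; 1, -ρ₂] : Matrix (Fin 2) (Fin 2) ℂ)) :
    (∀ k : ℤ, zIter γ γinv k 0 = ρ₁ * ρ₂ * ((μ : ℂ) ^ k - 1) / (ρ₁ * (μ : ℂ) ^ k - ρ₂)) ∧
    (∑' k : ℤ, (1 - ‖zIter γ γinv k 0‖ ^ 2)) =
      (∑' k : ℤ, 2 * (1 - ((starRingEnd ℂ) ρ₁ * ρ₂).re) * μ ^ k /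
        ‖(μ : ℂ) ^ k - (starRingEnd ℂ) ρ₁ * ρ₂‖ ^ 2) ∧
    Summable fun k : ℤ => 1 - ‖zIter γ γinv k 0‖ ^ 2 := by
  obtain ⟨α, hα⟩ := hnorm
  have hab : ρ₁ - ρ₂ ≠ 0 := sub_ne_zero.mpr hρne
  obtain ⟨hα0, hP, hQ, hR, hS⟩ := coeffs_of_conj_diag hab hα
  have hne : ∀ t : ℝ, 0 < t → ρ₁ * (t : ℂ) - ρ₂ ≠ 0 := fun t =>
    mul_ofReal_sub_ne_zero hρ₁ hρ₂ hρne
  have hμ0 : (μ : ℂ) ≠ 0 := Complex.ofReal_ne_zero.mpr hμpos.ne'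
  have hc : α * (ρ₁ - ρ₂) ≠ 0 := mul_ne_zero hα0 hab
  have hfwd : ∀ k : ℤ, γ (axisPoint ρ₁ ρ₂ (μ ^ k)) = axisPoint ρ₁ ρ₂ (μ ^ (k + 1)) := fun k => by
    rw [hγ, zpow_add_one₀ hμpos.ne', mul_comm (μ ^ k)]
    exact moebius_axisPoint hc hab (hne _ (by positivity)) hP hQ hR hS
  have hbwd : ∀ k : ℤ, γinv (axisPoint ρ₁ ρ₂ (μ ^ k)) = axisPoint ρ₁ ρ₂ (μ ^ (k - 1)) := fun k => by
    rw [hγinv, zpow_sub_one₀ hμpos.ne', mul_comm (μ ^ k)]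
    simp only [sub_eq_add_neg (p * _)]
    refine moebius_axisPoint (c := (μ : ℂ)⁻¹ * (α * (ρ₁ - ρ₂))) (mul_ne_zero (inv_ne_zero hμ0) hc)
      hab (hne _ (by positivity)) ?_ ?_ ?_ ?_
    · rw [mul_assoc, hS]
      push_cast
      field_simp
    · rw [mul_assoc, mul_neg, hQ]
      push_cast
      field_simp
      ring
    · rw [mul_assoc, mul_neg, hR]
      push_cast
      field_simp
      ring
    · rw [mul_assoc, hP]
      push_cast
      field_simp
  have horbit : ∀ k : ℤ, zIter γ γinv k 0 = axisPoint ρ₁ ρ₂ (μ ^ k) := fun k => by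
    have h := zIter_eq_of_step hfwd hbwd k
    rwa [show axisPoint ρ₁ ρ₂ (μ ^ (0 : ℤ)) = 0 by simp [axisPoint]] at h
  have hterm : ∀ k : ℤ, 1 - ‖zIter γ γinv k 0‖ ^ 2 =
      2 * (1 - ((starRingEnd ℂ) ρ₁ * ρ₂).re) * μ ^ k /
        ‖(μ : ℂ) ^ k - (starRingEnd ℂ) ρ₁ * ρ₂‖ ^ 2 := fun k => by
    rw [horbit, one_sub_norm_axisPoint_sq hρ₁ hρ₂ (hne _ (by positivity)), Complex.ofReal_zpow]
  have hw : ‖(starRingEnd ℂ) ρ₁ * ρ₂‖ = 1 := by simp [hρ₁, hρ₂]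
  have hw1 : ((starRingEnd ℂ) ρ₁ * ρ₂).re < 1 := by
    have h := norm_ofReal_sub_sq hw 1
    have hpos : 0 < ‖((1 : ℝ) : ℂ) - (starRingEnd ℂ) ρ₁ * ρ₂‖ ^ 2 := by
      refine pow_pos (norm_pos_iff.mpr fun h0 => hρne ?_) 2
      have haa : ρ₁ * (starRingEnd ℂ) ρ₁ = 1 := by simp [Complex.mul_conj', hρ₁]
      rw [Complex.ofReal_one] at h0
      linear_combination ρ₁ * h0 + ρ₂ * haa
    linarith
  refine ⟨fun k => ?_, tsum_congr hterm, ?_⟩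
  · rw [horbit, axisPoint, Complex.ofReal_zpow]
  · refine ((summable_zpow_div_one_add_sq hμpos hμne).mul_left 4).of_nonneg_of_le
      (fun k => ?_) fun k => ?_
    · rw [hterm]
      have : 0 < 1 - ((starRingEnd ℂ) ρ₁ * ρ₂).re := by linarith
      positivity
    · rw [hterm, ← Complex.ofReal_zpow]
      exact mul_div_norm_ofReal_sub_sq_le hw hw1 (by positivity)

end
end
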